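/- arXiv:math/0501205 — 4 statements merged into one kernel-verified Lean document; each statement's English description precedes it below -/
import Mathlib

section
/- Let α ∈ R^d be of constant type. Then the translation T_α on T^d has the monotone shrinking target property: for every x₀ ∈ T^d and every nonincreasing sequence r_n ≥ 0 with ∑ r_n^d = ∞, almost every x ∈ T^d satisfies T_α^n(x) ∈ B(x₀, r_n) for infinitely many n. -/
open MeasureTheory Filter Metric ENNReal Topology


/-- `‖v‖_ℤ`: the maximum over coordinates of the distance of `v i` to the nearest integer,
realized as the sup-distance to `0` in the torus `ℝ^d/ℤ^d`. -/
noncomputable def normZ {d : ℕ} (v : Fin d → ℝ) : ℝ :=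
  dist (fun i => ((v i : ℝ) : AddCircle (1:ℝ))) (0 : Fin d → AddCircle (1:ℝ))

abbrev Tor (d : ℕ) := Fin d → AddCircle (1:ℝ)

lemma circ_ball (x : AddCircle (1:ℝ)) (r : ℝ) :
    volume (ball x r) = ENNReal.ofReal (min 1 (2 * r)) := by
  rw [← AddCircle.volume_closedBall (1:ℝ) (x := x) r]
  exact (measure_congr AddCircle.closedBall_ae_eq_ball).symm

lemma tor_ball {d : ℕ} (hd : 0 < d) (x : Tor d) {r : ℝ} (hr : 0 ≤ r) :
    (volume : Measure (Tor d)).real (ball x r) = (min 1 (2 * r)) ^ d := by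
  rcases hr.eq_or_lt with rfl | hr
  · simp [hd.ne']
  · have h0 : 0 ≤ min 1 (2 * r) := by positivity
    rw [Measure.real, volume_pi_ball x hr]
    simp only [circ_ball, Finset.prod_const, Finset.card_univ, Fintype.card_fin]
    rw [ENNReal.toReal_pow, ENNReal.toReal_ofReal h0]

lemma tor_ball_eq {d : ℕ} (hd : 0 < d) (x : Tor d) {r : ℝ} (hr : 0 ≤ r) (hr1 : 2 * r ≤ 1) :
    (volume : Measure (Tor d)).real (ball x r) = (2 * r) ^ d := by
  rw [tor_ball hd x hr, min_eq_right hr1]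

lemma tor_ball_le {d : ℕ} (hd : 0 < d) (x : Tor d) {r : ℝ} (hr : 0 ≤ r) :
    (volume : Measure (Tor d)).real (ball x r) ≤ (2 * r) ^ d := by
  rw [tor_ball hd x hr]
  exact pow_le_pow_left₀ (by positivity) (min_le_right _ _) _

open Classical in
lemma step {d : ℕ} (hd : 0 < d) (p : ℕ → Tor d) (σ : ℕ → ℝ) (I J : Finset ℕ) (δ ρ : ℝ)
    (hδ : 0 < δ) (hδ1 : δ ≤ 1) (hρ : 0 ≤ ρ) (hρδ : ρ ≤ δ / 2) (hσ : ∀ n, 0 ≤ σ n)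
    (hsep : ∀ m ∈ J, ∀ n ∈ J, m ≠ n → δ ≤ dist (p m) (p n))
    (hcard : 4 ^ d * (I.card : ℝ) * δ ^ d + 2 ^ d * ∑ n ∈ I, (2 * σ n) ^ d
      ≤ (J.card : ℝ) / 2 * δ ^ d) :
    (volume : Measure (Tor d)).real (⋃ n ∈ I, ball (p n) (σ n)) + (J.card : ℝ) * (2 * ρ) ^ d / 2
      ≤ (volume : Measure (Tor d)).real
        ((⋃ n ∈ I, ball (p n) (σ n)) ∪ ⋃ m ∈ J, ball (p m) ρ) := by
  set U := ⋃ n ∈ I, ball (p n) (σ n) with hU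
  set G := J.filter (fun m => Disjoint U (ball (p m) ρ)) with hG
  set Bd := J.filter (fun m => ¬ Disjoint U (ball (p m) ρ)) with hBd
  have hdisj : ∀ t ≤ δ / 2, ∀ m ∈ J, ∀ n ∈ J, m ≠ n →
      Disjoint (ball (p m) t) (ball (p n) t) := by
    intro t ht m hm n hn hmn
    apply ball_disjoint_ball
    linarith [hsep m hm n hn hmn]
  have hbad : (Bd.card : ℝ) * δ ^ d ≤ ∑ n ∈ I, (2 * (σ n + δ)) ^ d := by
    have h1 : (volume : Measure (Tor d)).real (⋃ m ∈ Bd, ball (p m) (δ / 2))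
        = (Bd.card : ℝ) * δ ^ d := by
      rw [measureReal_biUnion_finset]
      · rw [Finset.sum_congr rfl (fun m _ => tor_ball_eq hd (p m) (by positivity) (by linarith))]
        simp only [Finset.sum_const, nsmul_eq_mul]
        congr 2; ring
      · intro m hm n hn hmn
        exact hdisj _ le_rfl m (Finset.mem_filter.1 hm).1 n (Finset.mem_filter.1 hn).1 hmn
      · intro m _; exact measurableSet_ball
    have h2 : (⋃ m ∈ Bd, ball (p m) (δ / 2)) ⊆ ⋃ n ∈ I, ball (p n) (σ n + δ) := by
      intro x hx
      simp only [Set.mem_iUnion] at hx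
      obtain ⟨m, hm, hx⟩ := hx
      have := (Finset.mem_filter.1 hm).2
      rw [Set.not_disjoint_iff] at this
      obtain ⟨y, hyU, hy⟩ := this
      rw [hU] at hyU
      simp only [Set.mem_iUnion] at hyU ⊢
      obtain ⟨n, hn, hyn⟩ := hyU
      refine ⟨n, hn, ?_⟩
      rw [mem_ball] at *
      have := dist_triangle x (p m) (p n)
      have h3 := dist_triangle (p m) y (p n)
      rw [dist_comm (p m) y] at h3
      linarith
    rw [← h1]
    refine (measureReal_mono h2 (measure_ne_top _ _)).trans ((measureReal_biUnion_finset_le _ _).trans ?_)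
    exact Finset.sum_le_sum fun n _ => tor_ball_le hd _ (add_nonneg (hσ n) hδ.le)
  have hb2 : ∑ n ∈ I, (2 * (σ n + δ)) ^ d
      ≤ 4 ^ d * (I.card : ℝ) * δ ^ d + 2 ^ d * ∑ n ∈ I, (2 * σ n) ^ d := by
    have : ∀ n ∈ I, (2 * (σ n + δ)) ^ d ≤ 4 ^ d * δ ^ d + 2 ^ d * (2 * σ n) ^ d := by
      intro n _
      have h := add_pow_le (hσ n) hδ.le d
      have h2 : (2:ℝ) ^ (d - 1) ≤ 2 ^ d := pow_le_pow_right₀ (by norm_num) (by omega)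
      have h3 : 0 ≤ σ n ^ d + δ ^ d := add_nonneg (pow_nonneg (hσ n) _) (by positivity)
      have h4 : (4:ℝ) ^ d = 2 ^ d * 2 ^ d := by rw [← mul_pow]; norm_num
      rw [mul_pow, mul_pow, h4]
      have h5 : (σ n + δ) ^ d ≤ 2 ^ d * (σ n ^ d + δ ^ d) :=
        h.trans (mul_le_mul_of_nonneg_right h2 h3)
      have h6 : (0:ℝ) ≤ 2 ^ d := by positivity
      nlinarith [mul_le_mul_of_nonneg_left h5 h6]
    refine (Finset.sum_le_sum this).trans (le_of_eq ?_)
    rw [Finset.sum_add_distrib, Finset.sum_const, ← Finset.mul_sum, nsmul_eq_mul]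
    ring
  have hbc : (Bd.card : ℝ) ≤ J.card / 2 := by
    have := (hbad.trans hb2).trans hcard
    exact le_of_mul_le_mul_right this (by positivity)
  have hGB : (G.card : ℝ) + Bd.card = J.card := by
    exact_mod_cast Finset.card_filter_add_card_filter_not (s := J) _
  have hGm : (volume : Measure (Tor d)).real (⋃ m ∈ G, ball (p m) ρ)
        = (G.card : ℝ) * (2 * ρ) ^ d := by
    rw [measureReal_biUnion_finset]
    · rw [Finset.sum_congr rfl (fun m _ => tor_ball_eq hd (p m) hρ (by linarith))]
      simp only [Finset.sum_const, nsmul_eq_mul]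
    · intro m hm n hn hmn
      exact hdisj _ hρδ m (Finset.mem_filter.1 hm).1 n (Finset.mem_filter.1 hn).1 hmn
    · intro m _; exact measurableSet_ball
  have hUG : Disjoint U (⋃ m ∈ G, ball (p m) ρ) := by
    simp only [Set.disjoint_iUnion_right]
    intro m hm
    exact (Finset.mem_filter.1 hm).2
  have hmG : MeasurableSet (⋃ m ∈ G, ball (p m) ρ) :=
    Finset.measurableSet_biUnion _ fun _ _ => measurableSet_ball
  have hsub : U ∪ (⋃ m ∈ G, ball (p m) ρ) ⊆ U ∪ ⋃ m ∈ J, ball (p m) ρ := by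
    apply Set.union_subset_union_right
    apply Set.biUnion_subset_biUnion_left
    intro m hm
    exact (Finset.mem_filter.1 hm).1
  calc _ ≤ (volume : Measure (Tor d)).real U + (G.card : ℝ) * (2 * ρ) ^ d := by
        have : 0 ≤ (2 * ρ) ^ d := by positivity
        nlinarith
    _ = (volume : Measure (Tor d)).real (U ∪ ⋃ m ∈ G, ball (p m) ρ) := by
        rw [measureReal_union hUG hmG (measure_ne_top _ _) (measure_ne_top _ _), hGm]
    _ ≤ _ := measureReal_mono hsub (measure_ne_top _ _)

/-- condensation -/
lemma condens {d B : ℕ} (hB : 2 ≤ B) (r : ℕ → ℝ) (hmono : Antitone r)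
    (hpos : ∀ n, 0 ≤ r n) (hdiv : ¬ Summable fun n => r n ^ d) (δ : ℕ → ℝ) (c : ℝ) (hc : 0 < c)
    (hδ0 : ∀ k, 0 ≤ δ k)
    (hδ : ∀ k, δ k ^ d * (B:ℝ) ^ (k + 1) = c) :
    ¬ Summable fun k : ℕ => ((B:ℝ) ^ (k + 1) - B ^ k) * (2 * min (r (B ^ (k + 1))) (δ k / 2)) ^ d := by
  intro hs
  apply hdiv
  have hB0 : (0:ℝ) < B := by positivity
  have hB2 : (2:ℝ) ≤ B := by exact_mod_cast hB
  rw [← summable_schlomilch_iff_of_nonneg (C := B) (u := fun k => B ^ k)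
    (fun n => pow_nonneg (hpos n) d)
    (fun m n _ h => pow_le_pow_left₀ (hpos n) (hmono h) d) (fun n => by positivity)
    (pow_right_strictMono₀ (by omega)) (by omega)
    (by intro n; simp only [smul_eq_mul, Nat.mul_sub, ← pow_succ']; exact le_rfl)]
  rw [← summable_nat_add_iff 1]
  have ht := hs.tendsto_atTop_zero
  have hev : ∀ᶠ k in atTop, ((B:ℝ) ^ (k + 1) - B ^ k) * (2 * min (r (B ^ (k + 1))) (δ k / 2)) ^ d
      < c * (1 - 1 / B) := by
    apply ht.eventually_lt_const
    apply mul_pos hc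
    rw [sub_pos, div_lt_one hB0]; linarith
  have hs2 : Summable fun k : ℕ => (B:ℝ) *
      (((B:ℝ) ^ (k + 1) - B ^ k) * (2 * min (r (B ^ (k + 1))) (δ k / 2)) ^ d) := hs.mul_left _
  refine Summable.of_norm_bounded_eventually_nat hs2 ?_
  filter_upwards [hev] with k hk
  have hBk : (0:ℝ) < B ^ k := by positivity
  have hdiff : (0:ℝ) ≤ (B:ℝ) ^ (k + 1) - B ^ k := by rw [pow_succ]; nlinarith
  have hmin : r (B ^ (k + 1)) ≤ δ k / 2 := by
    by_contra hcon
    rw [min_eq_right (not_le.1 hcon).le] at hk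
    have : 2 * (δ k / 2) = δ k := by ring
    rw [this, ← hδ k] at hk
    apply hk.ne
    field_simp
    ring
  rw [min_eq_left hmin, Real.norm_of_nonneg]
  · push_cast
    have h1 : r (B ^ (k + 1)) ^ d ≤ (2 * r (B ^ (k + 1))) ^ d :=
      pow_le_pow_left₀ (hpos _) (by linarith [hpos (B ^ (k + 1))]) d
    calc _ = (B:ℝ) * (((B:ℝ) ^ (k + 1) - B ^ k) * r (B ^ (k + 1)) ^ d) := by ring
      _ ≤ _ := by gcongr
  · push_cast
    apply mul_nonneg
    · have : (B:ℝ) ^ (k + 1 + 1) - B ^ (k + 1) = B * (B ^ (k+1) - B ^ k) := by ring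
      rw [this]; positivity
    · exact pow_nonneg (hpos _) _

lemma core {d : ℕ} (hd : 0 < d) (p : ℕ → Tor d) (C : ℝ) (hC : 0 < C) (hC1 : C ≤ 1)
    (hsep : ∀ N : ℕ, 1 ≤ N → ∀ m < N, ∀ n < N, m ≠ n →
      C * (N : ℝ) ^ (-(1:ℝ)/(d:ℝ)) ≤ dist (p m) (p n))
    (r : ℕ → ℝ) (hmono : Antitone r)
    (hpos : ∀ n, 0 ≤ r n) (hdiv : ¬ Summable fun n => r n ^ d) :
    ∃ c : ℝ, 0 < c ∧ ∀ M : ℕ, c ≤ (volume : Measure (Tor d)).real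
      (⋃ n ≥ M, ball (p n) (r n)) := by
  obtain ⟨B, hBdef⟩ : ∃ B : ℕ, B = 4 * 4 ^ d + 1 := ⟨_, rfl⟩
  have h4 : 1 ≤ 4 ^ d := Nat.one_le_pow _ _ (by norm_num)
  have hB : 2 ≤ B := by omega
  have hBr : (B:ℝ) = 4 * 4 ^ d + 1 := by rw [hBdef]; push_cast; ring
  have hB0 : (0:ℝ) < B := by positivity
  set δ : ℕ → ℝ := fun k => C * ((B ^ (k + 1) : ℕ) : ℝ) ^ (-(1:ℝ)/(d:ℝ)) with hδdef
  have hδpos : ∀ k, 0 < δ k := fun k => by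
    simp only [hδdef]; positivity
  have hδ1 : ∀ k, δ k ≤ 1 := fun k => by
    have : ((B ^ (k + 1) : ℕ) : ℝ) ^ (-(1:ℝ)/(d:ℝ)) ≤ 1 := by
      apply Real.rpow_le_one_of_one_le_of_nonpos
      · exact_mod_cast Nat.one_le_pow _ _ (by omega)
      · rw [neg_div]; simp
    simp only [hδdef]
    have h0 : 0 ≤ ((B ^ (k + 1) : ℕ) : ℝ) ^ (-(1:ℝ)/(d:ℝ)) := by positivity
    nlinarith
  have hδd : ∀ k, δ k ^ d * (B:ℝ) ^ (k + 1) = C ^ d := fun k => by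
    simp only [hδdef]
    rw [mul_pow, ← Real.rpow_natCast (((B ^ (k + 1) : ℕ) : ℝ) ^ (-(1:ℝ)/(d:ℝ))), ← Real.rpow_mul (by positivity)]
    have : -(1:ℝ)/(d:ℝ) * d = -1 := by field_simp
    rw [this, Real.rpow_neg_one]
    push_cast
    field_simp
  set ρ : ℕ → ℝ := fun k => min (r (B ^ (k + 1))) (δ k / 2) with hρdef
  have hρ0 : ∀ k, 0 ≤ ρ k := fun k => le_min (hpos _) (by linarith [hδpos k])
  set a : ℕ → ℝ := fun k => ((B:ℝ) ^ (k + 1) - B ^ k) * (2 * ρ k) ^ d with hadef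
  have hans : ¬ Summable a := condens hB r hmono hpos hdiv δ (C ^ d) (by positivity)
    (fun k => (hδpos k).le) hδd
  have ha0 : ∀ k, 0 ≤ a k := fun k => by
    apply mul_nonneg _ (pow_nonneg (by linarith [hρ0 k]) _)
    have : (0:ℝ) < B ^ k := by positivity
    have hB2 : (2:ℝ) ≤ B := by exact_mod_cast hB
    rw [pow_succ]; nlinarith
  set ε : ℝ := C ^ d * 4 ^ d / (2 ^ d * B) with hε
  have hεpos : 0 < ε := by positivity
  refine ⟨ε / 2, by positivity, fun M => ?_⟩
  set σ : ℕ → ℝ := fun n => ρ (Nat.log B n) with hσ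
  have hσblock : ∀ k, ∀ n ∈ Finset.Ico (B ^ k) (B ^ (k + 1)), σ n = ρ k := by
    intro k n hn
    rw [Finset.mem_Ico] at hn
    simp only [hσ]
    rw [Nat.log_eq_of_pow_le_of_lt_pow hn.1 hn.2]
  let I : ℕ → Finset ℕ := fun j => Finset.Ico (B ^ M) (B ^ (M + j))
  let J : ℕ → Finset ℕ := fun k => Finset.Ico (B ^ k) (B ^ (k + 1))
  have hJcard : ∀ k, ((J k).card : ℝ) = (B:ℝ) ^ (k + 1) - B ^ k := by
    intro k
    simp only [J, Nat.card_Ico]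
    rw [Nat.cast_sub (Nat.pow_le_pow_right (by omega) (by omega))]
    push_cast; ring
  have hJsum : ∀ k, ∑ n ∈ J k, (2 * σ n) ^ d = a k := by
    intro k
    rw [Finset.sum_congr rfl (fun n hn => by rw [hσblock k n hn])]
    rw [Finset.sum_const, nsmul_eq_mul, hJcard]
  have hIsucc : ∀ j, I (j + 1) = I j ∪ J (M + j) := by
    intro j
    simp only [I, J]
    rw [Finset.Ico_union_Ico_eq_Ico]
    · rfl
    · exact Nat.pow_le_pow_right (by omega) (by omega)
    · exact Nat.pow_le_pow_right (by omega) (by omega)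
  have hIsum : ∀ j, ∑ n ∈ I j, (2 * σ n) ^ d = ∑ i ∈ Finset.range j, a (M + i) := by
    intro j
    induction j with
    | zero => simp [I]
    | succ j ih =>
      rw [Finset.sum_range_succ, ← ih, hIsucc, Finset.sum_union, hJsum]
      exact Finset.Ico_disjoint_Ico_consecutive _ _ _
  set S : ℕ → ℝ := fun j => ∑ i ∈ Finset.range j, a (M + i) with hS
  set U : ℕ → Set (Tor d) := fun j => ⋃ n ∈ I j, ball (p n) (σ n) with hU
  have hUsucc : ∀ j, U (j + 1) = U j ∪ ⋃ n ∈ J (M + j), ball (p n) (ρ (M + j)) := by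
    intro j
    simp only [hU, hIsucc, Finset.set_biUnion_union]
    congr 1
    apply Set.iUnion₂_congr
    intro n hn
    rw [hσblock _ n hn]
  have key : ∀ j, min (S j) ε / 2 ≤ (volume : Measure (Tor d)).real (U j) := by
    intro j
    induction j with
    | zero => simp [hS, hU, I, hεpos.le]
    | succ j ih =>
      have hle : (volume : Measure (Tor d)).real (U j) ≤
          (volume : Measure (Tor d)).real (U (j + 1)) := by
        rw [hUsucc]; exact measureReal_mono Set.subset_union_left (measure_ne_top _ _)
      by_cases hSj : S j ≤ ε
      · rw [min_eq_left hSj] at ih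
        have hst := step hd p σ (I j) (J (M + j)) (δ (M + j)) (ρ (M + j)) (hδpos _) (hδ1 _)
          (hρ0 _) (min_le_right _ _) (fun n => hρ0 _) (by
            intro m hm n hn hmn
            exact hsep (B ^ (M + j + 1)) (Nat.one_le_pow _ _ (by omega)) m
              (Finset.mem_Ico.1 hm).2 n (Finset.mem_Ico.1 hn).2 hmn) (by
            rw [hIsum, hJcard]
            have hIc : ((I j).card : ℝ) ≤ B ^ (M + j) := by
              simp only [I, Nat.card_Ico]
              exact_mod_cast Nat.sub_le _ _
            have hdd := hδd (M + j)
            have hD : 0 < δ (M + j) ^ d := pow_pos (hδpos _) _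
            have e1 : (2:ℝ) ^ d * ε = 4 ^ d * B ^ (M + j) * δ (M + j) ^ d := by
              rw [hε, ← hdd, pow_succ]
              field_simp
            have e2 : (2:ℝ) ^ d * S j ≤ 2 ^ d * ε := by gcongr
            have e3 : (4:ℝ) ^ d * ((I j).card : ℝ) * δ (M + j) ^ d
              ≤ 4 ^ d * B ^ (M + j) * δ (M + j) ^ d := by gcongr
            have e4 : ((B:ℝ) ^ (M + j + 1) - B ^ (M + j)) / 2 * δ (M + j) ^ d
              = 2 * (4 ^ d * B ^ (M + j) * δ (M + j) ^ d) := by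
              rw [pow_succ]
              have : (B:ℝ) ^ (M + j) * B = (B:ℝ) ^ (M + j) * (4 * 4 ^ d + 1) := by rw [← hBr]
              rw [this]; ring
            rw [e4]
            linarith)
        rw [hJcard] at hst
        have hSs : S (j + 1) = S j + a (M + j) := Finset.sum_range_succ _ _
        have h7 : min (S (j + 1)) ε ≤ S j + a (M + j) := by rw [← hSs]; exact min_le_left _ _
        rw [hUsucc]
        simp only [hU] at ih ⊢
        simp only [hadef] at h7
        linarith
      · have : min (S (j + 1)) ε ≤ min (S j) ε := by
          rw [min_eq_right (not_le.1 hSj).le]; exact min_le_right _ _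
        linarith
  have hSlarge : ∃ j, ε ≤ S j := by
    by_contra hcon
    push Not at hcon
    apply hans
    rw [← summable_nat_add_iff M]
    apply summable_of_sum_range_le (c := ε) (fun n => ha0 _)
    intro n
    have := (hcon n).le
    simp only [hS] at this
    simpa only [add_comm] using this
  obtain ⟨j, hj⟩ := hSlarge
  have hk := key j
  rw [min_eq_right hj] at hk
  refine hk.trans (measureReal_mono ?_ (measure_ne_top _ _))
  intro x hx
  simp only [hU, Set.mem_iUnion] at hx ⊢
  obtain ⟨n, hn, hx⟩ := hx
  have hn' := Finset.mem_Ico.1 hn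
  refine ⟨n, ?_, ?_⟩
  · exact ((Nat.lt_pow_self (by omega)).le).trans hn'.1
  · refine ball_subset_ball ?_ hx
    refine (min_le_left _ _).trans (hmono ?_)
    exact (Nat.lt_pow_succ_log_self (by omega) n).le

lemma limsup_pos {d : ℕ} (hd : 0 < d) (p : ℕ → Tor d) (C : ℝ) (hC : 0 < C) (hC1 : C ≤ 1)
    (hsep : ∀ N : ℕ, 1 ≤ N → ∀ m < N, ∀ n < N, m ≠ n →
      C * (N : ℝ) ^ (-(1:ℝ)/(d:ℝ)) ≤ dist (p m) (p n))
    (r : ℕ → ℝ) (hmono : Antitone r)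
    (hpos : ∀ n, 0 ≤ r n) (hdiv : ¬ Summable fun n => r n ^ d) :
    0 < (volume : Measure (Tor d)) (⋂ M : ℕ, ⋃ n ≥ M, ball (p n) (r n)) := by
  obtain ⟨c, hc, h⟩ := core hd p C hC hC1 hsep r hmono hpos hdiv
  have ht := tendsto_measure_iInter_atTop (μ := (volume : Measure (Tor d)))
    (s := fun M : ℕ => ⋃ n ≥ M, ball (p n) (r n))
    (fun M => (MeasurableSet.biUnion (Set.to_countable _)
      fun _ _ => measurableSet_ball).nullMeasurableSet)
    (by
      intro M N hMN
      exact Set.biUnion_subset_biUnion_left fun n (hn : N ≤ n) => hMN.trans hn)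
    ⟨0, measure_ne_top _ _⟩
  have h2 : ENNReal.ofReal c ≤ (volume : Measure (Tor d)) (⋂ M : ℕ, ⋃ n ≥ M, ball (p n) (r n)) := by
    refine ge_of_tendsto' ht fun M => ?_
    exact ENNReal.ofReal_le_of_le_toReal (h M)
  exact lt_of_lt_of_le (ENNReal.ofReal_pos.2 hc) h2

lemma mem_limsup {d : ℕ} (g x₀ x : Tor d) (r : ℕ → ℝ) :
    x ∈ (⋂ M : ℕ, ⋃ n ≥ M, ball (x₀ - n • g) (r n)) ↔ ∃ᶠ n in atTop, x + n • g ∈ ball x₀ (r n) := by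
  simp only [Set.mem_iInter, Set.mem_iUnion, frequently_atTop, exists_prop, mem_ball]
  have : ∀ n : ℕ, dist x (x₀ - n • g) = dist (x + n • g) x₀ := by
    intro n
    rw [← dist_add_right x (x₀ - n • g) (n • g), sub_add_cancel]
  simp only [this]

lemma dense_of_sep {d : ℕ} (hd : 0 < d) (g : Tor d) (C : ℝ) (hC : 0 < C) (hC1 : C ≤ 1)
    (hsep : ∀ N : ℕ, 1 ≤ N → ∀ m < N, ∀ n < N, m ≠ n →
      C * (N : ℝ) ^ (-(1:ℝ)/(d:ℝ)) ≤ dist ((0 : Tor d) - m • g) (0 - n • g)) :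
    DenseRange (fun n : ℤ => n • g) := by
  set r : ℕ → ℝ := fun n => ((n:ℝ) + 1) ^ (-(1:ℝ)/(d:ℝ)) with hr
  have hneg : -(1:ℝ)/(d:ℝ) < 0 := by
    rw [neg_div, neg_lt_zero]; positivity
  have hW := limsup_pos hd (fun n : ℕ => (0 : Tor d) - n • g) C hC hC1 hsep r (by
      intro m n hmn
      simp only [hr]
      apply Real.rpow_le_rpow_of_nonpos (by positivity) _ hneg.le
      have : (m:ℝ) ≤ n := by exact_mod_cast hmn
      linarith) (fun n => by simp only [hr]; positivity) (by
      intro hs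
      have : ∀ n : ℕ, r n ^ d = 1 / ((n + 1 : ℕ) : ℝ) := by
        intro n
        simp only [hr]
        rw [← Real.rpow_natCast, ← Real.rpow_mul (by positivity)]
        have : -(1:ℝ)/(d:ℝ) * d = -1 := by field_simp
        rw [this, Real.rpow_neg_one]
        push_cast; simp
      simp only [this] at hs
      exact Real.not_summable_one_div_natCast ((summable_nat_add_iff 1).1 hs))
  set H : AddSubgroup (Tor d) := (AddSubgroup.zmultiples g).topologicalClosure with hH
  have hr0 : Tendsto r atTop (𝓝 0) := by
    have h1 : Tendsto (fun n : ℕ => (n:ℝ) + 1) atTop atTop :=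
      tendsto_atTop_add_const_right _ _ tendsto_natCast_atTop_atTop
    have h2 := (tendsto_rpow_neg_atTop (y := 1 / (d:ℝ)) (by positivity)).comp h1
    refine h2.congr fun n => ?_
    simp only [hr, Function.comp, neg_div]
  have hsub : (⋂ M : ℕ, ⋃ n ≥ M, ball ((0 : Tor d) - n • g) (r n)) ⊆ (H : Set (Tor d)) := by
    intro x hx
    rw [hH, AddSubgroup.topologicalClosure_coe, Metric.mem_closure_iff]
    intro e he
    simp only [Set.mem_iInter, Set.mem_iUnion] at hx
    obtain ⟨M, hM⟩ := (hr0.eventually_lt_const he).exists_forall_of_atTop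
    obtain ⟨n, hn, hxn⟩ := hx M
    refine ⟨0 - n • g, ?_, (mem_ball.1 hxn).trans (hM n hn)⟩
    exact AddSubgroup.sub_mem _ (AddSubgroup.zero_mem _)
      (AddSubgroup.nsmul_mem _ (AddSubgroup.mem_zmultiples g) n)
  have hHpos : 0 < (volume : Measure (Tor d)) (H : Set (Tor d)) :=
    hW.trans_le (measure_mono hsub)
  have hclosed : IsClosed (H : Set (Tor d)) := AddSubgroup.isClosed_topologicalClosure _
  have hnh := Measure.sub_mem_nhds_zero_of_addHaar_pos (volume : Measure (Tor d))
    (H : Set (Tor d)) hclosed.measurableSet hHpos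
  have hopen : IsOpen (H : Set (Tor d)) := by
    apply AddSubgroup.isOpen_of_mem_nhds H (g := 0)
    refine mem_of_superset hnh ?_
    rintro _ ⟨a, ha, b, hb, rfl⟩
    exact H.sub_mem ha hb
  have huniv : (H : Set (Tor d)) = Set.univ :=
    IsClopen.eq_univ ⟨hclosed, hopen⟩ ⟨0, H.zero_mem⟩
  rw [hH, AddSubgroup.topologicalClosure_coe] at huniv
  have : Dense ((AddSubgroup.zmultiples g : AddSubgroup (Tor d)) : Set (Tor d)) :=
    dense_iff_closure_eq.2 huniv
  rwa [AddSubgroup.coe_zmultiples] at this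

/-- A translation by a constant type vector has the monotone shrinking target property. -/
theorem stmt7 (d : ℕ) (hd : 0 < d) (α : Fin d → ℝ)
    (hα : ∃ C : ℝ, 0 < C ∧ ∀ Q : ℤ, Q ≠ 0 →
      C * |(Q : ℝ)| ^ (-(1:ℝ)/(d:ℝ)) ≤ normZ (fun i => (Q : ℝ) * α i))
    (x₀ : Fin d → AddCircle (1:ℝ)) (r : ℕ → ℝ) (hmono : Antitone r) (hpos : ∀ n, 0 ≤ r n)
    (hdiv : ¬ Summable fun n => r n ^ d) :
    ∀ᵐ x ∂(volume : Measure (Fin d → AddCircle (1:ℝ))), ∃ᶠ n in atTop,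
      (fun y => y + fun i => ((α i : ℝ) : AddCircle (1:ℝ)))^[n] x ∈ ball x₀ (r n) := by
  obtain ⟨C₀, hC₀, hα⟩ := hα
  set g : Tor d := fun i => ((α i : ℝ) : AddCircle (1:ℝ)) with hg
  have hnorm : ∀ Q : ℤ, normZ (fun i => (Q : ℝ) * α i) = dist (Q • g) 0 := by
    intro Q
    unfold normZ
    congr 1
    funext i
    simp only [hg, Pi.smul_apply]
    rw [← AddCircle.coe_zsmul, zsmul_eq_mul]
  set C := min C₀ 1 with hC
  have hCpos : 0 < C := lt_min hC₀ one_pos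
  have hneg : -(1:ℝ)/(d:ℝ) ≤ 0 := by
    rw [neg_div, neg_nonpos]; positivity
  have hsep : ∀ z : Tor d, ∀ N : ℕ, 1 ≤ N → ∀ m < N, ∀ n < N, m ≠ n →
      C * (N : ℝ) ^ (-(1:ℝ)/(d:ℝ)) ≤ dist (z - m • g) (z - n • g) := by
    intro z N hN m hm n hn hmn
    have hQ : ((n:ℤ) - m) ≠ 0 := by omega
    have h := hα _ hQ
    rw [hnorm] at h
    have hd1 : dist (z - m • g) (z - n • g) = dist (((n:ℤ) - m) • g) 0 := by
      rw [dist_eq_norm, dist_eq_norm, sub_zero, sub_smul]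
      congr 1
      simp only [natCast_zsmul]
      abel
    rw [hd1]
    refine le_trans ?_ h
    have habs : |(((n:ℤ) - m : ℤ) : ℝ)| ≤ N := by
      have : |(n:ℤ) - m| ≤ N := by rw [abs_le]; omega
      exact_mod_cast this
    have habs0 : 0 < |(((n:ℤ) - m : ℤ) : ℝ)| := by
      rw [abs_pos]; exact_mod_cast hQ
    exact mul_le_mul (min_le_left _ _) (Real.rpow_le_rpow_of_nonpos habs0 habs hneg)
      (by positivity) hC₀.le
  have hdense := dense_of_sep hd g C hCpos (min_le_right _ _) (hsep 0)
  have herg := ergodic_add_left_of_denseRange_zsmul hdense (volume : Measure (Tor d))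
  have hiter : ∀ (n : ℕ) (x : Tor d), (fun y => y + g)^[n] x = x + n • g := by
    intro n x
    rw [add_right_iterate]
  simp only [hiter]
  have hW := limsup_pos hd (fun n : ℕ => x₀ - n • g) C hCpos (min_le_right _ _) (hsep x₀) r
    hmono hpos hdiv
  set W := (⋂ M : ℕ, ⋃ n ≥ M, ball (x₀ - n • g) (r n)) with hWdef
  have hWm : MeasurableSet W := MeasurableSet.iInter fun M =>
    MeasurableSet.biUnion (Set.to_countable _) fun _ _ => measurableSet_ball
  have hinv : W ⊆ (fun x => g + x) ⁻¹' W := by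
    intro x hx
    rw [Set.mem_preimage, hWdef, mem_limsup, frequently_atTop]
    rw [hWdef, mem_limsup, frequently_atTop] at hx
    intro M
    obtain ⟨n, hn, hxn⟩ := hx (M + 1)
    obtain ⟨k, rfl⟩ : ∃ k, n = k + 1 := ⟨n - 1, by omega⟩
    refine ⟨k, by omega, ball_subset_ball (hmono (Nat.le_succ k)) ?_⟩
    have : g + x + k • g = x + (k + 1) • g := by rw [succ_nsmul]; abel
    rw [this]; exact hxn
  have hW2 : ∀ᵐ x ∂(volume : Measure (Tor d)), x ∈ W := by
    rcases herg.ae_empty_or_univ_of_ae_le_preimage hWm.nullMeasurableSet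
      (HasSubset.Subset.eventuallyLE hinv) with h | h
    · rw [ae_eq_empty] at h
      exact absurd h hW.ne'
    · exact eventuallyEq_univ.1 h
  filter_upwards [hW2] with x hx
  exact (mem_limsup g x₀ x r).1 hx
end

section
/- Fix ε > 0, an integer Q ≥ 4, numbers r_0 ≥ r_1 ≥ … ≥ r_{2Q−1} ≥ 0, and points y_0, …, y_{2Q−1} in T^d such that the balls B(y_l, ε/Q^{1/d}), l = 0,…,2Q−1, are pairwise disjoint. Then at least one of the following holds: (i) μ(⋃_{l=0}^{Q−1} B(y_l, r_l)) ≥ V(d)(ε/10)^d, or (ii) μ(⋃_{l=0}^{2Q−1} B(y_l, r_l)) ≥ μ(⋃_{l=0}^{Q−1} B(y_l, r_l)) + (Q/2)·μ(B(y_0, r_{2Q−1})). -/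
open MeasureTheory Filter Metric ENNReal Topology

lemma aux_vol (d : ℕ) (x : Fin d → AddCircle (1:ℝ)) (s : ℝ) (hs : 0 < s) (hs' : s ≤ 1/2) :
    volume (ball x s) = ENNReal.ofReal ((2*s)^d) := by
  have h1 : ∀ a : AddCircle (1:ℝ), volume (ball a s) = ENNReal.ofReal (2*s) := by
    intro a
    rw [← measure_congr (AddCircle.closedBall_ae_eq_ball (x := a) (ε := s)),
      AddCircle.volume_closedBall]
    rw [min_eq_right]
    linarith
  rw [ball_pi _ hs, volume_pi_pi]
  simp only [h1, Finset.prod_const, Finset.card_univ, Fintype.card_fin]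
  rw [ENNReal.ofReal_pow (by linarith)]

lemma aux_lift (a : AddCircle (1:ℝ)) : ∃ t : ℝ, (t : AddCircle (1:ℝ)) = a ∧ |t| = ‖a‖ := by
  induction a using QuotientAddGroup.induction_on with
  | H x =>
    refine ⟨x - round x, ?_, ?_⟩
    · have : ((round x : ℝ) : AddCircle (1:ℝ)) = 0 := by
        rw [AddCircle.coe_eq_zero_iff]
        exact ⟨round x, by simp⟩
      rw [AddCircle.coe_sub, this, sub_zero]
    · have := AddCircle.norm_eq (p := (1:ℝ)) (x := x)
      simp only [inv_one, one_mul, mul_one] at this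
      exact this.symm

lemma aux_norm (t : ℝ) : ‖(t : AddCircle (1:ℝ))‖ ≤ |t| := by
  have := AddCircle.norm_eq (p := (1:ℝ)) (x := t)
  simp only [inv_one, one_mul, mul_one] at this
  rw [this]
  simpa using round_le t 0

lemma aux_dist_half (d : ℕ) (x y : Fin d → AddCircle (1:ℝ)) : dist x y ≤ 1/2 := by
  rw [dist_pi_le_iff (by norm_num)]
  intro i
  rw [dist_eq_norm]
  have := AddCircle.norm_le_half_period (p := (1:ℝ)) (x := x i - y i) one_ne_zero
  simpa using this

lemma aux_geo (d : ℕ) (y z : Fin d → AddCircle (1:ℝ)) (η R : ℝ) (hη : 0 < η) (hR : η ≤ R)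
    (h : dist z y < R) : ∃ w, dist w z ≤ η ∧ dist w y ≤ R - η := by
  choose a ha hna using fun i => aux_lift (z i - y i)
  have hR0 : 0 < R := by linarith
  have hai : ∀ i, |a i| ≤ R := fun i => by
    rw [hna, ← dist_eq_norm]
    exact (dist_le_pi_dist z y i).trans h.le
  refine ⟨fun i => y i + ((((R-η)/R) * a i : ℝ) : AddCircle (1:ℝ)), ?_, ?_⟩
  · rw [dist_pi_le_iff hη.le]
    intro i
    rw [dist_comm, dist_eq_norm]
    have : z i - (y i + ((((R-η)/R) * a i : ℝ) : AddCircle (1:ℝ)))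
        = ((η/R * a i : ℝ) : AddCircle (1:ℝ)) := by
      rw [← sub_sub, ← ha i, ← AddCircle.coe_sub]
      congr 1
      field_simp
      ring
    rw [this]
    refine (aux_norm _).trans ?_
    rw [abs_mul, abs_of_pos (by positivity)]
    calc η/R * |a i| ≤ η/R * R := by gcongr; exact hai i
      _ = η := by field_simp
  · rw [dist_pi_le_iff (by linarith)]
    intro i
    rw [dist_eq_norm, add_sub_cancel_left]
    refine (aux_norm _).trans ?_
    have : 0 ≤ (R-η)/R := div_nonneg (by linarith) hR0.le
    rw [abs_mul, abs_of_nonneg this]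
    calc (R-η)/R * |a i| ≤ (R-η)/R * R := by gcongr; exact hai i
      _ = R - η := by field_simp

theorem stmt10 (d : ℕ) (hd : 0 < d) (ε : ℝ) (hε : 0 < ε) (Q : ℕ) (hQ : 4 ≤ Q)
    (r : ℕ → ℝ) (hrpos : ∀ n, 0 ≤ r n)
    (hmono : ∀ l l' : ℕ, l ≤ l' → l' < 2*Q → r l' ≤ r l)
    (y : ℕ → (Fin d → AddCircle (1:ℝ)))
    (hdisj : ∀ l l' : ℕ, l < 2*Q → l' < 2*Q → l ≠ l' →
      Disjoint (ball (y l) (ε / (Q:ℝ) ^ ((1:ℝ)/(d:ℝ))))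
               (ball (y l') (ε / (Q:ℝ) ^ ((1:ℝ)/(d:ℝ))))) :
    ENNReal.ofReal ((2:ℝ)^d * (ε/10)^d) ≤ volume (⋃ l ∈ Finset.range Q, ball (y l) (r l)) ∨
    volume (⋃ l ∈ Finset.range Q, ball (y l) (r l)) +
        ((Q : ℝ≥0∞)/2) * volume (ball (y 0) (r (2*Q-1)))
      ≤ volume (⋃ l ∈ Finset.range (2*Q), ball (y l) (r l)) := by
  classical
  have hQ0 : (0:ℝ) < Q := by exact_mod_cast (by omega : 0 < Q)
  have hδpos : 0 < ε / (Q:ℝ) ^ ((1:ℝ)/(d:ℝ)) := by positivity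
  have hδQ : (Q:ℝ) * (ε / (Q:ℝ) ^ ((1:ℝ)/(d:ℝ)))^d = ε^d := by
    rw [div_pow, one_div, Real.rpow_inv_natCast_pow hQ0.le hd.ne']
    field_simp
  generalize ε / (Q:ℝ) ^ ((1:ℝ)/(d:ℝ)) = δ at *
  have hsep : ∀ l l' : ℕ, l < 2*Q → l' < 2*Q → l ≠ l' → δ ≤ dist (y l) (y l') := by
    intro l l' hl hl' hne
    by_contra! hlt
    exact Set.disjoint_left.1 (hdisj l l' hl hl' hne) (mem_ball_self hδpos)
      (by rwa [mem_ball])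
  have hδ2 : δ ≤ 1/2 :=
    (hsep 0 1 (by omega) (by omega) (by omega)).trans (aux_dist_half _ _ _)
  have key : (2:ℝ)^d * (ε/10)^d = Q * (2*(δ/10))^d := by
    rw [mul_pow, div_pow, div_pow, ← hδQ]; ring
  -- packing
  have pack : ∀ (S : Finset ℕ) (c : ℕ → (Fin d → AddCircle (1:ℝ))) (s : ℝ)
      (V : Set (Fin d → AddCircle (1:ℝ))), 0 < s → s ≤ 1/2 → (∀ l ∈ S, l < 2*Q) →
      (∀ l ∈ S, ball (c l) s ⊆ ball (y l) δ) → (∀ l ∈ S, ball (c l) s ⊆ V) →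
      ENNReal.ofReal (S.card * (2*s)^d) ≤ volume V := by
    intro S c s V hs hs' hS hsub hV
    have h1 : volume (⋃ l ∈ S, ball (c l) s) = ∑ l ∈ S, volume (ball (c l) s) := by
      apply measure_biUnion_finset
      · intro l hl l' hl' hne
        exact (hdisj l l' (hS l hl) (hS l' hl') hne).mono (hsub l hl) (hsub l' hl')
      · intro l _
        exact measurableSet_ball
    simp only [aux_vol d _ s hs hs', Finset.sum_const, nsmul_eq_mul] at h1
    rw [ENNReal.ofReal_mul (by positivity), ENNReal.ofReal_natCast, ← h1]
    exact measure_mono (Set.iUnion₂_subset hV)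
  set U := ⋃ l ∈ Finset.range Q, ball (y l) (r l) with hU
  by_cases hr : δ/10 ≤ r (Q-1)
  · left
    rw [key]
    have := pack (Finset.range Q) y (δ/10) U (by linarith) (by linarith)
      (fun l hl => by rw [Finset.mem_range] at hl; omega)
      (fun l _ => ball_subset_ball (by linarith))
      (fun l hl => by
        have hl' := Finset.mem_range.1 hl
        exact (ball_subset_ball (hr.trans (hmono l (Q-1) (by omega) (by omega)))).trans
          (Set.subset_biUnion_of_mem (u := fun l => ball (y l) (r l)) hl))
    rwa [Finset.card_range] at this
  push Not at hr
  have hsmall : ∀ l, Q ≤ l → l < 2*Q → r l < δ/10 := fun l h1 h2 =>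
    (hmono (Q-1) l (by omega) h2).trans_lt hr
  set G := (Finset.Ico Q (2*Q)).filter (fun l => Disjoint U (ball (y l) (r l))) with hG
  set B := (Finset.Ico Q (2*Q)).filter (fun l => ¬ Disjoint U (ball (y l) (r l))) with hB
  have hcard : G.card + B.card = Q := by
    rw [hG, hB, Finset.card_filter_add_card_filter_not, Nat.card_Ico]; omega
  by_cases hg : Q ≤ 2 * G.card
  · right
    have hGmem : ∀ l ∈ G, (Q ≤ l ∧ l < 2*Q) ∧ Disjoint U (ball (y l) (r l)) := fun l hl => by
      simpa [hG] using hl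
    have h1 : volume (⋃ l ∈ G, ball (y l) (r l)) = ∑ l ∈ G, volume (ball (y l) (r l)) := by
      apply measure_biUnion_finset
      · intro l hl l' hl' hne
        have a := (hGmem l hl).1
        have b := (hGmem l' hl').1
        exact (hdisj l l' a.2 b.2 hne).mono
          (ball_subset_ball (by linarith [hsmall l a.1 a.2]))
          (ball_subset_ball (by linarith [hsmall l' b.1 b.2]))
      · intro l _
        exact measurableSet_ball
    have h2 : volume (U ∪ ⋃ l ∈ G, ball (y l) (r l))
        = volume U + volume (⋃ l ∈ G, ball (y l) (r l)) := by
      apply measure_union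
      · rw [Set.disjoint_iUnion₂_right]
        exact fun l hl => (hGmem l hl).2
      · exact Finset.measurableSet_biUnion _ fun l _ => measurableSet_ball
    have h3 : (U ∪ ⋃ l ∈ G, ball (y l) (r l)) ⊆ ⋃ l ∈ Finset.range (2*Q), ball (y l) (r l) := by
      apply Set.union_subset
      · exact Set.biUnion_subset_biUnion_left fun l hl => by
          simp at hl ⊢; omega
      · exact Set.biUnion_subset_biUnion_left fun l hl => by
          have := (hGmem l hl).1
          simp; omega
    refine le_trans ?_ (measure_mono h3)
    rw [h2, h1]
    gcongr
    have h4 : ∀ l ∈ G, volume (ball (y 0) (r (2*Q-1))) ≤ volume (ball (y l) (r l)) := by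
      intro l hl
      have a := (hGmem l hl).1
      have hle := hmono l (2*Q-1) (by omega) (by omega)
      refine le_trans ?_ (measure_mono (ball_subset_ball hle))
      rcases (hrpos (2*Q-1)).eq_or_lt with h0 | h0
      · simp [← h0]
      · have := hsmall l a.1 a.2
        rw [aux_vol d _ _ h0 (by linarith), aux_vol d _ _ h0 (by linarith)]
    calc (Q : ℝ≥0∞)/2 * volume (ball (y 0) (r (2*Q-1)))
        ≤ (G.card : ℝ≥0∞) * volume (ball (y 0) (r (2*Q-1))) := by
          gcongr
          apply ENNReal.div_le_of_le_mul
          rw [mul_comm]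
          exact_mod_cast hg
      _ = ∑ l ∈ G, volume (ball (y 0) (r (2*Q-1))) := by simp
      _ ≤ _ := Finset.sum_le_sum h4
  · left
    have hb : Q ≤ 2 * B.card := by omega
    have hBmem : ∀ l ∈ B, (Q ≤ l ∧ l < 2*Q) ∧ ¬ Disjoint U (ball (y l) (r l)) := fun l hl => by
      simpa [hB] using hl
    have hex : ∀ l, ∃ w, l ∈ B → ball w (δ/5) ⊆ ball (y l) δ ∧ ball w (δ/5) ⊆ U := by
      intro l
      by_cases hl : l ∈ B
      swap
      · exact ⟨y l, fun h => absurd h hl⟩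
      obtain ⟨⟨a, b⟩, hnd⟩ := hBmem l hl
      obtain ⟨z, hzU, hzl⟩ := Set.not_disjoint_iff.1 hnd
      rw [hU] at hzU
      simp only [Set.mem_iUnion, Finset.mem_range, mem_ball, exists_prop] at hzU
      obtain ⟨k, hk, hzk⟩ := hzU
      rw [mem_ball] at hzl
      have hs := hsmall l a b
      have hd1 := hsep l k b (by omega) (by omega)
      have htri := dist_triangle_left (y l) (y k) z
      obtain ⟨w, hw1, hw2⟩ := aux_geo d (y k) z (δ/5) (r k) (by linarith) (by linarith) hzk
      refine ⟨w, fun _ => ⟨ball_subset_ball' ?_, ?_⟩⟩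
      · have := dist_triangle w z (y l)
        linarith
      · refine (ball_subset_ball' (y := y k) (ε₂ := r k) (by linarith)).trans ?_
        exact Set.subset_biUnion_of_mem (u := fun l => ball (y l) (r l))
          (Finset.mem_range.2 hk)
    choose w hw using hex
    refine le_trans (ENNReal.ofReal_le_ofReal ?_) (pack B w (δ/5) U (by linarith) (by linarith)
      (fun l hl => (hBmem l hl).1.2) (fun l hl => (hw l hl).1) (fun l hl => (hw l hl).2))
    rw [key]
    have hb' : (Q:ℝ) ≤ 2 * B.card := by exact_mod_cast hb
    have h2d : (2:ℝ) ≤ 2^d := by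
      simpa using pow_le_pow_right₀ (by norm_num : (1:ℝ) ≤ 2) hd
    have e : (2*(δ/5))^d = 2^d * (2*(δ/10))^d := by rw [← mul_pow]; congr 1; ring
    rw [e, ← mul_assoc]
    have : (Q:ℝ) ≤ B.card * 2^d := by
      have : (0:ℝ) ≤ B.card := by positivity
      nlinarith
    gcongr
end

section
/- If a probability measure-preserving system (T, M, μ) has the property that every sequence of measurable sets taking only finitely many distinct values, none of measure zero, is Borel–Cantelli, then T is weak mixing. -/
open MeasureTheory Filter Metric ENNReal Topology
open scoped symmDiff

theorem aux_mean {X : Type*} [MeasurableSpace X] (ν : Measure X) [IsProbabilityMeasure ν]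
    (F : X → X) (hF : Ergodic F ν) (A B : Set X) (hA : MeasurableSet A) (hB : MeasurableSet B) :
    Tendsto (fun N : ℕ => (N : ℝ)⁻¹ * ∑ n ∈ Finset.range N, ν.real ((F^[n]) ⁻¹' A ∩ B))
      atTop (𝓝 (ν.real A * ν.real B)) := by
  have hmp := hF.toMeasurePreserving
  let U : Lp ℝ 2 ν →L[ℝ] Lp ℝ 2 ν :=
    (Lp.compMeasurePreservingₗᵢ ℝ F hmp : Lp ℝ 2 ν →ₗᵢ[ℝ] Lp ℝ 2 ν).toContinuousLinearMap
  have hU : ‖U‖ ≤ 1 := LinearIsometry.norm_toContinuousLinearMap_le _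
  let h : Lp ℝ 2 ν := indicatorConstLp 2 hA (measure_ne_top ν A) 1
  have key := U.tendsto_birkhoffAverage_orthogonalProjection hU h
  set k := (U.eqLocus (1 : Lp ℝ 2 ν →L[ℝ] Lp ℝ 2 ν)).orthogonalProjectionOnto h with hk
  have hUk : U (k : Lp ℝ 2 ν) = k := k.2
  have hUk' : Lp.compMeasurePreserving F hmp (k : Lp ℝ 2 ν) = k := hUk
  obtain ⟨c, hc⟩ : ∃ c : ℝ, (k : Lp ℝ 2 ν) =ᵐ[ν] Function.const X c := by
    apply hF.ae_eq_const_of_ae_eq_comp_ae (Lp.aestronglyMeasurable _)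
    have := Lp.coeFn_compMeasurePreserving (k : Lp ℝ 2 ν) hmp
    rw [hUk'] at this
    exact this.symm
  have hit : ∀ n, U^[n] h = indicatorConstLp 2 ((hmp.iterate n).measurable hA)
      (measure_ne_top ν _) (1 : ℝ) := by
    intro n
    have h1 : U^[n] = (Lp.compMeasurePreserving F hmp)^[n] := rfl
    rw [h1, Lp.compMeasurePreserving_iterate]
    exact Lp.indicatorConstLp_compMeasurePreserving hA (measure_ne_top ν A) 1 (hmp.iterate n)
  have gen : ∀ C : Set X, MeasurableSet C →
      Tendsto (fun N : ℕ => (N : ℝ)⁻¹ * ∑ n ∈ Finset.range N, ν.real ((F^[n]) ⁻¹' A ∩ C))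
      atTop (𝓝 (c * ν.real C)) := by
    intro C hC
    have h2 := (tendsto_const_nhds (x := (indicatorConstLp 2 hC (measure_ne_top ν C) (1:ℝ)))).inner
      (𝕜 := ℝ) key
    have h3 : inner ℝ (indicatorConstLp 2 hC (measure_ne_top ν C) (1:ℝ)) (k : Lp ℝ 2 ν)
        = c * ν.real C := by
      rw [L2.inner_indicatorConstLp_one, setIntegral_congr_ae (g := fun _ => c) hC]
      · simp [mul_comm]
      · filter_upwards [hc] with x hx _ using hx
    rw [h3] at h2
    refine h2.congr fun N => ?_
    simp only [birkhoffAverage, birkhoffSum, id, inner_smul_right, inner_sum, hit,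
      L2.real_inner_indicatorConstLp_one_indicatorConstLp_one, Set.inter_comm]
  have hcA : c = ν.real A := by
    have h4 := gen Set.univ MeasurableSet.univ
    have h5 : Tendsto (fun N : ℕ => (N : ℝ)⁻¹ * ∑ n ∈ Finset.range N,
        ν.real ((F^[n]) ⁻¹' A ∩ Set.univ)) atTop (𝓝 (ν.real A)) := by
      refine tendsto_const_nhds.congr' ?_
      filter_upwards [eventually_gt_atTop 0] with N hN
      have : (N : ℝ) ≠ 0 := by positivity
      simp [measureReal_def, (hmp.iterate _).measure_preimage hA.nullMeasurableSet, this]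
    simpa using tendsto_nhds_unique h4 h5
  rw [← hcA]
  exact gen B hB

theorem aux_sections {M : Type*} [mM : MeasurableSpace M] (S : Set (M × M)) (hS : MeasurableSet S) :
    ∃ C : Set (Set M), C.Countable ∧ (∀ c ∈ C, MeasurableSet c) ∧
      ∀ x, MeasurableSet[MeasurableSpace.generateFrom C] (Prod.mk x ⁻¹' S) := by
  induction S, hS using MeasurableSpace.induction_on_inter generateFrom_prod.symm isPiSystem_prod with
  | empty => exact ⟨∅, by simp, by simp, fun x => by simp⟩
  | basic t ht =>
    obtain ⟨a, ha, b, hb, rfl⟩ := ht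
    refine ⟨{b}, by simp, by simpa using hb, fun x => ?_⟩
    by_cases hx : x ∈ a
    · rw [Set.mk_preimage_prod_right hx]
      exact MeasurableSpace.measurableSet_generateFrom rfl
    · rw [Set.mk_preimage_prod_right_eq_empty hx]
      exact @MeasurableSet.empty _ (MeasurableSpace.generateFrom {b})
  | compl t ht ih =>
    obtain ⟨C, h1, h2, h3⟩ := ih
    exact ⟨C, h1, h2, fun x => MeasurableSet.compl (h3 x)⟩
  | iUnion f hd hf ih =>
    choose C h1 h2 h3 using ih
    refine ⟨⋃ i, C i, Set.countable_iUnion h1, ?_, fun x => ?_⟩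
    · simp only [Set.mem_iUnion]
      rintro c ⟨i, hi⟩
      exact h2 i c hi
    · rw [Set.preimage_iUnion]
      refine MeasurableSet.iUnion fun i => ?_
      exact MeasurableSpace.generateFrom_mono (Set.subset_iUnion C i) _ (h3 i x)

theorem aux_dense0 {M : Type*} [m : MeasurableSpace M] (ν : Measure M) [IsFiniteMeasure ν]
    (C : Set (Set M)) (hm : m = MeasurableSpace.generateFrom C) :
    (∀ c ∈ generateSetAlgebra C, MeasurableSet c) ∧ ∀ s, MeasurableSet s → ∀ ε : ℝ, 0 < ε →
      ∃ t ∈ generateSetAlgebra C, ν (s ∆ t) < ENNReal.ofReal ε := by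
  have hd := Measure.MeasureDense.of_generateFrom_isSetAlgebra_finite ν
    (isSetAlgebra_generateSetAlgebra (𝒜 := C)) (by rw [generateFrom_generateSetAlgebra_eq, hm])
  exact ⟨hd.measurable, fun s hs ε hε => hd.approx s hs (measure_ne_top ν s) ε hε⟩

theorem aux_dense {M : Type*} [mM : MeasurableSpace M] (μ : Measure M) [IsProbabilityMeasure μ]
    (S : Set (M × M)) (hS : MeasurableSet S) :
    ∃ D : Set (Set M), D.Countable ∧ (∀ c ∈ D, MeasurableSet c) ∧
      ∀ x, ∀ ε : ℝ, 0 < ε → ∃ t ∈ D, μ ((Prod.mk x ⁻¹' S) ∆ t) < ENNReal.ofReal ε := by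
  obtain ⟨C, h1, h2, h3⟩ := aux_sections S hS
  have hle : MeasurableSpace.generateFrom C ≤ mM := MeasurableSpace.generateFrom_le h2
  have hd := @aux_dense0 M (MeasurableSpace.generateFrom C) (μ.trim hle)
    (isFiniteMeasure_trim hle) C rfl
  refine ⟨generateSetAlgebra C, countable_generateSetAlgebra h1,
    fun c hc => hle _ (hd.1 c hc), fun x ε hε => ?_⟩
  obtain ⟨t, ht, hlt⟩ := hd.2 _ (h3 x) ε hε
  refine ⟨t, ht, ?_⟩
  have hm : MeasurableSet[MeasurableSpace.generateFrom C] ((Prod.mk x ⁻¹' S) ∆ t) :=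
    @MeasurableSet.symmDiff M (MeasurableSpace.generateFrom C) _ _ (h3 x) (hd.1 t ht)
  rwa [trim_measurableSet_eq hle hm] at hlt

section
variable {M : Type*} [MeasurableSpace M] (μ : Measure M) [IsProbabilityMeasure μ]
    (T : M → M)

theorem aux_two_hit (hT : MeasurePreserving T μ μ)
    (hbc : ∀ A : ℕ → Set M, (∀ n, MeasurableSet (A n)) → (Set.range A).Finite →
      (∀ n, 0 < μ (A n)) → μ {x | ∃ᶠ n in atTop, T^[n] x ∈ A n} = 1)
    (A B₁ B₂ : Set M) (h₁m : MeasurableSet B₁) (h₂m : MeasurableSet B₂)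
    (hA : 0 < μ A) (h₁ : 0 < μ B₁) (h₂ : 0 < μ B₂) :
    ∃ n : ℕ, 0 < μ (A ∩ T^[n] ⁻¹' B₁) ∧ 0 < μ (A ∩ T^[n] ⁻¹' B₂) := by
  classical
  by_contra! hcon
  let E : ℕ → Set M := fun n => if μ (A ∩ T^[n] ⁻¹' B₁) = 0 then B₁ else B₂
  have hE : ∀ n, E n = B₁ ∨ E n = B₂ := by
    intro n; by_cases h : μ (A ∩ T^[n] ⁻¹' B₁) = 0 <;> simp [E, h]
  have hm : ∀ n, MeasurableSet (E n) := fun n => by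
    rcases hE n with h | h <;> rw [h] <;> assumption
  have hnull : ∀ n, μ (A ∩ T^[n] ⁻¹' E n) = 0 := by
    intro n
    by_cases h : μ (A ∩ T^[n] ⁻¹' B₁) = 0
    · simp [E, h]
    · simpa [E, h] using hcon n (pos_iff_ne_zero.2 h)
  have h1 := hbc E hm
    ((Set.toFinite {B₁, B₂}).subset (by rintro _ ⟨n, rfl⟩; simpa using hE n))
    (fun n => by rcases hE n with h | h <;> rw [h] <;> assumption)
  have hLm : MeasurableSet {x | ∃ᶠ n in atTop, T^[n] x ∈ E n} := by
    have : {x | ∃ᶠ n in atTop, T^[n] x ∈ E n} = limsup (fun n => T^[n] ⁻¹' E n) atTop := by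
      ext x; simp [mem_limsup_iff_frequently_mem]
    rw [this]
    exact MeasurableSet.measurableSet_limsup fun n => (hT.iterate n).measurable (hm n)
  have h2 : μ {x | ∃ᶠ n in atTop, T^[n] x ∈ E n}ᶜ = 0 := (prob_compl_eq_zero_iff hLm).2 h1
  have h3 : μ (⋃ n, A ∩ T^[n] ⁻¹' E n) = 0 := measure_iUnion_null hnull
  refine hA.ne' (measure_mono_null ?_ (measure_union_null h2 h3))
  intro x hx
  by_cases hf : ∃ᶠ n in atTop, T^[n] x ∈ E n
  · right
    obtain ⟨n, hn⟩ := hf.exists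
    exact Set.mem_iUnion.2 ⟨n, hx, hn⟩
  · left; exact hf

theorem aux_inv (hT : MeasurePreserving T μ μ)
    (hbc : ∀ A : ℕ → Set M, (∀ n, MeasurableSet (A n)) → (Set.range A).Finite →
      (∀ n, 0 < μ (A n)) → μ {x | ∃ᶠ n in atTop, T^[n] x ∈ A n} = 1)
    (C : Set M) (hC : MeasurableSet C) (hinv : T ⁻¹' C =ᵐ[μ] C) : μ C = 0 ∨ μ C = 1 := by
  by_contra! hcon
  have h1 : 0 < μ C := pos_iff_ne_zero.2 hcon.1
  have h2 : 0 < μ Cᶜ := pos_iff_ne_zero.2 fun h => hcon.2 ((prob_compl_eq_zero_iff hC).1 h)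
  obtain ⟨n, hn, -⟩ := aux_two_hit μ T hT hbc Cᶜ C C hC hC h2 h1 h1
  have h3 : T^[n] ⁻¹' C =ᵐ[μ] C := hT.quasiMeasurePreserving.preimage_iterate_ae_eq n hinv
  refine hn.ne' ?_
  have h4 : (Cᶜ ∩ T^[n] ⁻¹' C : Set M) =ᵐ[μ] (Cᶜ ∩ C : Set M) :=
    ae_eq_set_inter (ae_eq_refl _) h3
  rw [measure_congr h4]
  simp

theorem aux_ergodic (hT : MeasurePreserving T μ μ)
    (hbc : ∀ A : ℕ → Set M, (∀ n, MeasurableSet (A n)) → (Set.range A).Finite →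
      (∀ n, 0 < μ (A n)) → μ {x | ∃ᶠ n in atTop, T^[n] x ∈ A n} = 1) :
    Ergodic (Prod.map T T) (μ.prod μ) := by
  refine ⟨hT.prod hT, ⟨fun S hS hSinv => ?_⟩⟩
  have hsm : ∀ x, MeasurableSet (Prod.mk x ⁻¹' S) := fun x => measurable_prodMk_left hS
  have hsec : ∀ n x, T^[n] ⁻¹' (Prod.mk (T^[n] x) ⁻¹' S) = Prod.mk x ⁻¹' S := by
    intro n
    induction n with
    | zero => intro x; rfl
    | succ n ih =>
      intro x
      rw [← ih x]
      ext y
      have := Set.ext_iff.1 hSinv (T^[n] x, T^[n] y)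
      simpa only [Set.mem_preimage, Function.iterate_succ_apply', Prod.map_apply] using this
  have hd : ∀ n x y, μ ((Prod.mk (T^[n] x) ⁻¹' S) ∆ (Prod.mk (T^[n] y) ⁻¹' S)) =
      μ ((Prod.mk x ⁻¹' S) ∆ (Prod.mk y ⁻¹' S)) := by
    intro n x y
    rw [← (hT.iterate n).measure_preimage ((hsm _).symmDiff (hsm _)).nullMeasurableSet,
      Set.preimage_symmDiff, hsec, hsec]
  obtain ⟨D, hDc, hDm, hD⟩ := aux_dense μ S hS
  let G : ℝ≥0∞ → Set M → Set M := fun δ t => {x | μ ((Prod.mk x ⁻¹' S) ∆ t) < δ}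
  have hGm : ∀ δ, ∀ t ∈ D, MeasurableSet (G δ t) := by
    intro δ t ht
    have : Measurable fun x => μ (Prod.mk x ⁻¹' (S ∆ (Set.univ ×ˢ t))) :=
      measurable_measure_prodMk_left (hS.symmDiff (MeasurableSet.univ.prod (hDm t ht)))
    have h2 : ∀ x, Prod.mk x ⁻¹' (S ∆ (Set.univ ×ˢ t)) = (Prod.mk x ⁻¹' S) ∆ t := by
      intro x; rw [Set.preimage_symmDiff]; simp
    simp only [h2] at this
    exact this measurableSet_Iio
  have hclose : ∀ δ, ∀ t₁ ∈ D, ∀ t₂ ∈ D, 0 < μ (G δ t₁) → 0 < μ (G δ t₂) →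
      μ (t₁ ∆ t₂) ≤ δ + (δ + δ) + δ := by
    intro δ t₁ ht₁ t₂ ht₂ h₁ h₂
    obtain ⟨n, hn1, hn2⟩ := aux_two_hit μ T hT hbc (G δ t₁) (G δ t₁) (G δ t₂)
      (hGm δ t₁ ht₁) (hGm δ t₂ ht₂) h₁ h₁ h₂
    obtain ⟨x, hx1, hx2⟩ := nonempty_of_measure_ne_zero hn1.ne'
    obtain ⟨y, hy1, hy2⟩ := nonempty_of_measure_ne_zero hn2.ne'
    have hx1 : μ ((Prod.mk x ⁻¹' S) ∆ t₁) < δ := hx1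
    have hx2 : μ ((Prod.mk (T^[n] x) ⁻¹' S) ∆ t₁) < δ := hx2
    have hy1 : μ ((Prod.mk y ⁻¹' S) ∆ t₁) < δ := hy1
    have hy2 : μ ((Prod.mk (T^[n] y) ⁻¹' S) ∆ t₂) < δ := hy2
    calc μ (t₁ ∆ t₂) ≤ μ (t₁ ∆ (Prod.mk (T^[n] y) ⁻¹' S)) + μ ((Prod.mk (T^[n] y) ⁻¹' S) ∆ t₂) :=
          measure_symmDiff_le _ _ _
      _ ≤ (μ (t₁ ∆ (Prod.mk (T^[n] x) ⁻¹' S)) +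
          μ ((Prod.mk (T^[n] x) ⁻¹' S) ∆ (Prod.mk (T^[n] y) ⁻¹' S))) + δ :=
          add_le_add (measure_symmDiff_le _ _ _) hy2.le
      _ ≤ δ + (δ + δ) + δ := by
          rw [hd]
          gcongr
          · rw [symmDiff_comm]; exact hx2.le
          · refine (measure_symmDiff_le _ t₁ _).trans (add_le_add hx1.le ?_)
            rw [symmDiff_comm]; exact hy1.le
  let ε : ℕ → ℝ := fun k => 1 / ((k : ℝ) + 1)
  have hε : ∀ k, 0 < ε k := fun k => by positivity
  have hgood : ∀ᵐ x ∂μ, ∀ k : ℕ, ∀ t ∈ D, x ∈ G (ENNReal.ofReal (ε k)) t →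
      0 < μ (G (ENNReal.ofReal (ε k)) t) := by
    rw [ae_all_iff]; intro k
    rw [ae_ball_iff hDc]; intro t ht
    by_cases h : μ (G (ENNReal.ofReal (ε k)) t) = 0
    · filter_upwards [measure_eq_zero_iff_ae_notMem.1 h] with x hx hx'
      exact absurd hx' hx
    · exact Eventually.of_forall fun x _ => pos_iff_ne_zero.2 h
  obtain ⟨p, hp⟩ := hgood.exists
  have hzero : ∀ᵐ x ∂μ, (Prod.mk x ⁻¹' S : Set M) =ᵐ[μ] (Prod.mk p ⁻¹' S : Set M) := by
    filter_upwards [hgood] with x hx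
    rw [← measure_symmDiff_eq_zero_iff]
    have hb : ∀ k, μ ((Prod.mk x ⁻¹' S) ∆ (Prod.mk p ⁻¹' S)) ≤ ENNReal.ofReal (6 * ε k) := by
      intro k
      obtain ⟨t, ht, htx⟩ := hD x (ε k) (hε k)
      obtain ⟨s, hs, hsp⟩ := hD p (ε k) (hε k)
      have h5 := hclose _ t ht s hs (hx k t ht htx) (hp k s hs hsp)
      have h6 : ENNReal.ofReal (6 * ε k) = ENNReal.ofReal (ε k) + ((ENNReal.ofReal (ε k) +
          (ENNReal.ofReal (ε k) + ENNReal.ofReal (ε k)) + ENNReal.ofReal (ε k)) +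
          ENNReal.ofReal (ε k)) := by
        have := (hε k).le
        rw [← ENNReal.ofReal_add, ← ENNReal.ofReal_add, ← ENNReal.ofReal_add,
          ← ENNReal.ofReal_add, ← ENNReal.ofReal_add] <;> first | positivity | (congr 1; ring)
      rw [h6]
      refine (measure_symmDiff_le _ t _).trans (add_le_add htx.le ?_)
      refine (measure_symmDiff_le _ s _).trans (add_le_add h5 ?_)
      rw [symmDiff_comm]; exact hsp.le
    have hlim : Tendsto (fun k => ENNReal.ofReal (6 * ε k)) atTop (𝓝 0) := by
      rw [← ENNReal.ofReal_zero]
      refine ENNReal.tendsto_ofReal ?_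
      simpa [ε] using (tendsto_one_div_add_atTop_nhds_zero_nat (𝕜 := ℝ)).const_mul 6
    exact le_antisymm (ge_of_tendsto' hlim hb) zero_le
  have hinv : T ⁻¹' (Prod.mk p ⁻¹' S) =ᵐ[μ] (Prod.mk p ⁻¹' S : Set M) := by
    obtain ⟨x, hx1, hx2⟩ := (hzero.and (hT.quasiMeasurePreserving.ae hzero)).exists
    have h7 := hT.quasiMeasurePreserving.preimage_ae_eq hx2
    have h8 : T ⁻¹' (Prod.mk (T x) ⁻¹' S) = Prod.mk x ⁻¹' S := hsec 1 x
    rw [h8] at h7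
    exact h7.symm.trans hx1
  have hprod : (μ.prod μ) S = μ (Prod.mk p ⁻¹' S) := by
    rw [Measure.prod_apply hS, lintegral_congr_ae (g := fun _ => μ (Prod.mk p ⁻¹' S))]
    · simp
    · filter_upwards [hzero] with x hx using measure_congr hx
  rw [eventuallyConst_set']
  rcases aux_inv μ T hT hbc _ (hsm p) hinv with h | h
  · left
    rw [ae_eq_empty, hprod, h]
  · right
    rw [ae_eq_univ, prob_compl_eq_zero_iff hS, hprod, h]

end

/-- If every sequence taking finitely many distinct positive-measure values is
Borel–Cantelli, then the system is weak mixing. -/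
theorem stmt13 {M : Type*} [MeasurableSpace M] (μ : Measure M) [IsProbabilityMeasure μ]
    (T : M → M) (hT : MeasurePreserving T μ μ)
    (hbc : ∀ A : ℕ → Set M, (∀ n, MeasurableSet (A n)) → (Set.range A).Finite →
      (∀ n, 0 < μ (A n)) → μ {x | ∃ᶠ n in atTop, T^[n] x ∈ A n} = 1) :
    ∀ A B : Set M, MeasurableSet A → MeasurableSet B →
      Tendsto (fun N : ℕ => (1 / (N : ℝ)) * ∑ n ∈ Finset.range N,
        |(μ ((T^[n]) ⁻¹' A ∩ B)).toReal - (μ A).toReal * (μ B).toReal|) atTop (𝓝 0) := by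
  intro A B hA hB
  have herg := aux_ergodic μ T hT hbc
  have hset : ∀ (n : ℕ) (C E : Set M), (Prod.map T T)^[n] ⁻¹' (A ×ˢ C) ∩ (B ×ˢ E) =
      (T^[n] ⁻¹' A ∩ B) ×ˢ (T^[n] ⁻¹' C ∩ E) := by
    intro n C E
    ext ⟨x, y⟩
    simp only [Prod.map_iterate, Set.mem_inter_iff, Set.mem_preimage, Set.mem_prod, Prod.map_apply]
    tauto
  have h1 := aux_mean _ _ herg (A ×ˢ Set.univ) (B ×ˢ Set.univ)
    (hA.prod MeasurableSet.univ) (hB.prod MeasurableSet.univ)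
  have h2 := aux_mean _ _ herg (A ×ˢ A) (B ×ˢ B) (hA.prod hA) (hB.prod hB)
  simp only [hset, measureReal_prod_prod, Set.preimage_univ, Set.inter_self, probReal_univ,
    mul_one] at h1 h2
  simp only [← measureReal_def]
  obtain ⟨u, hu⟩ : ∃ u : ℕ → ℝ, ∀ n, μ.real (T^[n] ⁻¹' A ∩ B) = u n := ⟨_, fun _ => rfl⟩
  simp only [hu] at h1 h2 ⊢
  set a := μ.real A
  set b := μ.real B
  have h3 : Tendsto (fun N : ℕ => (N : ℝ)⁻¹ * ∑ n ∈ Finset.range N, (u n - a * b) ^ 2)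
      atTop (𝓝 0) := by
    have h4 := (h2.sub (h1.const_mul (2 * (a * b)))).add_const ((a * b) ^ 2)
    have h5 : a * a * (b * b) - 2 * (a * b) * (a * b) + (a * b) ^ 2 = 0 := by ring
    rw [h5] at h4
    refine h4.congr' ?_
    filter_upwards [eventually_gt_atTop 0] with N hN
    have hN' : (N : ℝ) ≠ 0 := by positivity
    have h6 : ∀ n, (u n - a * b) ^ 2 = u n * u n - 2 * (a * b) * u n + (a * b) ^ 2 := by
      intro n; ring
    simp only [h6, Finset.sum_add_distrib, Finset.sum_sub_distrib, ← Finset.mul_sum,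
      Finset.sum_const, Finset.card_range, nsmul_eq_mul]
    field_simp
  have h7 := h3.sqrt
  rw [Real.sqrt_zero] at h7
  refine squeeze_zero (fun N => by positivity) (fun N => ?_) h7
  apply Real.le_sqrt_of_sq_le
  rcases Nat.eq_zero_or_pos N with rfl | hN
  · simp
  have h8 := sq_sum_le_card_mul_sum_sq (s := Finset.range N) (f := fun n => |u n - a * b|)
  simp only [Finset.card_range, sq_abs] at h8
  have hN' : (0 : ℝ) < N := by positivity
  rw [mul_pow]
  calc (1 / (N : ℝ)) ^ 2 * (∑ n ∈ Finset.range N, |u n - a * b|) ^ 2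
      ≤ (1 / (N : ℝ)) ^ 2 * (N * ∑ n ∈ Finset.range N, (u n - a * b) ^ 2) := by gcongr
    _ = (N : ℝ)⁻¹ * ∑ n ∈ Finset.range N, (u n - a * b) ^ 2 := by field_simp
end

section
/- Let α ∈ R^d be such that there is a sequence of positive integers Q_n with Q_{n+1} ≥ 2Q_n and ‖Q_n α‖_Z ≤ 1/(n^{2d+5} Q_n^{2/d}). Let φ ∈ C¹(T^{d+1}, R_{>0}) and let T^t be the reparametrization of the linear flow in direction (α,1) by φ, with invariant probability measure μ_φ of density proportional to 1/φ. Then the time-one map T¹ does not have the monotone shrinking target property: for every x ∈ T^{d+1} there is a nonincreasing sequence r_n with ∑ r_n^{d+1} = ∞ such that μ_φ(limsup_n T^{-n} B(x, r_n)) = 0. -/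
open MeasureTheory Filter Metric ENNReal Topology


lemma core_aux {X : Type*} [PseudoMetricSpace X] [MeasurableSpace X] (μ : Measure X) (T : X → X)
    (x : X) (D : ℕ) (ρ : ℕ → ℝ) (N : ℕ → ℕ) (h0 : ∀ k, 0 ≤ ρ k) (h1 : ∀ k, ρ k ≤ 1)
    (hN : ∀ B : ℝ, ∃ k, B < N k * ρ k ^ D)
    (hE : ∑' k, μ {y | ∃ n ≤ N k, T^[n] y ∈ ball x (ρ k)} ≠ ⊤) :
    ∃ r : ℕ → ℝ, Antitone r ∧ (∀ n, 0 ≤ r n) ∧ ¬ Summable (fun n => r n ^ D) ∧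
      μ {y | ∃ᶠ n in atTop, T^[n] y ∈ ball x (r n)} = 0 := by
  classical
  set f : ℕ → ℕ → ℝ := fun n k => if n ≤ N k then ρ k else 0 with hf
  have hbdd : ∀ n, BddAbove (Set.range (f n)) := by
    intro n
    refine ⟨1, ?_⟩
    rintro _ ⟨k, rfl⟩
    simp only [hf]
    split_ifs
    · exact h1 k
    · exact zero_le_one
  have hf0 : ∀ n k, 0 ≤ f n k := by
    intro n k
    simp only [hf]
    split_ifs
    · exact h0 k
    · exact le_rfl
  have hr0 : ∀ n, 0 ≤ ⨆ k, f n k := fun n => Real.iSup_nonneg (hf0 n)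
  have hanti : Antitone (fun n => ⨆ k, f n k) := by
    intro a b hab
    refine ciSup_mono (hbdd a) ?_
    intro k
    simp only [hf]
    split_ifs with h2 h3 h3
    · exact le_rfl
    · omega
    · exact h0 k
    · exact le_rfl
  refine ⟨fun n => ⨆ k, f n k, hanti, hr0, ?_, ?_⟩
  · intro hs
    obtain ⟨k, hk⟩ := hN (∑' n, (⨆ k, f n k) ^ D)
    have e1 : ρ k ≤ ⨆ j, f (N k) j := by
      have := le_ciSup (hbdd (N k)) k
      simpa [hf] using this
    have e2 : ∑ i ∈ Finset.range (N k), ρ k ^ D ≤ ∑ i ∈ Finset.range (N k), (⨆ j, f i j) ^ D := by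
      refine Finset.sum_le_sum fun i hi => ?_
      refine pow_le_pow_left₀ (h0 k) (e1.trans (hanti ?_)) _
      exact (Finset.mem_range.1 hi).le
    have e3 := hs.sum_le_tsum (Finset.range (N k)) (fun i _ => pow_nonneg (hr0 i) D)
    simp only [Finset.sum_const, Finset.card_range, nsmul_eq_mul] at e2
    linarith
  · refine measure_mono_null ?_ (measure_setOfPred_frequently_eq_zero hE)
    intro y hy
    simp only [Set.mem_ofPred_eq] at hy ⊢
    rw [Filter.frequently_atTop] at hy ⊢
    intro a
    obtain ⟨n, hn, hb⟩ := hy ((Finset.range a).sup N + 1)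
    rw [mem_ball] at hb
    obtain ⟨k, hk⟩ := exists_lt_of_lt_ciSup hb
    simp only [hf] at hk
    split_ifs at hk with h
    · refine ⟨k, ?_, n, h, hk⟩
      by_contra hlt
      have := Finset.le_sup (f := N) (Finset.mem_range.2 (not_le.1 hlt))
      omega
    · exact absurd dist_nonneg (not_le.2 hk)

/-- projection to the torus -/
def prj {D : ℕ} (y : Fin D → ℝ) : Fin D → AddCircle (1:ℝ) := fun i => ((y i : ℝ) : AddCircle (1:ℝ))

lemma prj_norm_le {D : ℕ} (y : Fin D → ℝ) : ‖prj y‖ ≤ ‖y‖ := by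
  rw [pi_norm_le_iff_of_nonneg (norm_nonneg _)]
  intro i
  refine le_trans ?_ (norm_le_pi_norm y i)
  exact QuotientAddGroup.norm_mk_le_norm

lemma prj_surj {D : ℕ} (y : Fin D → AddCircle (1:ℝ)) : ∃ z, prj z = y := by
  choose z hz using fun i => QuotientAddGroup.mk_surjective (y i)
  exact ⟨z, funext hz⟩

lemma prj_surj' {D : ℕ} (y : Fin D → AddCircle (1:ℝ)) :
    ∃ z ∈ Set.Icc (0 : Fin D → ℝ) 1, prj z = y := by
  obtain ⟨z, rfl⟩ := prj_surj y
  refine ⟨fun i => Int.fract (z i), ⟨fun i => Int.fract_nonneg _, fun i => (Int.fract_lt_one _).le⟩, ?_⟩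
  funext i
  simp only [prj]
  rw [← sub_eq_zero, ← AddCircle.coe_sub, AddCircle.coe_eq_zero_iff]
  refine ⟨-⌊z i⌋, ?_⟩
  have := Int.self_sub_floor (z i)
  simp only [zsmul_eq_mul, mul_one]
  push_cast
  linarith

lemma cover_aux {d : ℕ} (α : Fin d → ℝ) (q : ℕ) (hq : 1 ≤ q) (δ L ρ h : ℝ)
    (hδ : normZ (fun i => (q : ℝ) * α i) ≤ δ) (hL : L * δ ≤ ρ) (hh : 0 < h)
    (hhρ : h * ‖(Fin.snoc α (1:ℝ) : Fin (d+1) → ℝ)‖ ≤ ρ)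
    (x z : Fin (d+1) → AddCircle (1:ℝ)) (hz : z ∈ ball x ρ) (s : ℝ) (hs0 : 0 ≤ s) (hs : s ≤ L * q) :
    ∃ m ∈ Finset.range (⌊(q:ℝ) / h⌋₊ + 1),
      z - prj (s • (Fin.snoc α (1:ℝ) : Fin (d+1) → ℝ)) ∈
        ball (x - prj (((m:ℝ) * h) • (Fin.snoc α (1:ℝ) : Fin (d+1) → ℝ))) (3 * ρ) := by
  set v : Fin (d+1) → ℝ := Fin.snoc α (1:ℝ) with hv
  have hq0 : (0:ℝ) < q := by exact_mod_cast hq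
  have hδ0 : 0 ≤ δ := le_trans dist_nonneg hδ
  set j := ⌊s / q⌋₊ with hj
  have hj1 : (j:ℝ) ≤ s / q := Nat.floor_le (by positivity)
  have hj2 : s / q < j + 1 := Nat.lt_floor_add_one _
  have hj1' : (j:ℝ) * q ≤ s := by rwa [le_div_iff₀ hq0] at hj1
  have hj2' : s < (j + 1) * q := by rwa [div_lt_iff₀ hq0] at hj2
  have hjL : (j:ℝ) ≤ L := hj1.trans (by rwa [div_le_iff₀ hq0])
  set s' := s - j * q with hs'
  have hs'0 : 0 ≤ s' := by simp only [hs']; linarith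
  have hs'q : s' ≤ q := by simp only [hs']; linarith
  set m := ⌊s' / h⌋₊ with hm
  have hm1 : (m:ℝ) ≤ s' / h := Nat.floor_le (by positivity)
  have hm2 : s' / h < m + 1 := Nat.lt_floor_add_one _
  have hm1' : (m:ℝ) * h ≤ s' := by rwa [le_div_iff₀ hh] at hm1
  have hm2' : s' < (m + 1) * h := by rwa [div_lt_iff₀ hh] at hm2
  refine ⟨m, ?_, ?_⟩
  · rw [Finset.mem_range, Nat.lt_succ_iff]
    exact Nat.floor_le_floor (by gcongr)
  · rw [mem_ball, dist_eq_norm] at hz ⊢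
    have key : z - prj (s • v) - (x - prj (((m:ℝ) * h) • v)) =
        (z - x) - (j • prj ((q:ℝ) • v) + prj ((s' - m * h) • v)) := by
      funext i
      have : s * v i = j • ((q:ℝ) * v i) + (s' - m * h) * v i + m * h * v i := by
        simp only [hs', nsmul_eq_mul]; ring
      simp only [prj, Pi.sub_apply, Pi.add_apply, Pi.smul_apply, smul_eq_mul]
      rw [this]
      rw [AddCircle.coe_add, AddCircle.coe_add, AddCircle.coe_nsmul]
      abel
    have n1 : ‖prj ((q:ℝ) • v)‖ ≤ δ := by
      rw [pi_norm_le_iff_of_nonneg hδ0]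
      intro i
      refine Fin.lastCases ?_ (fun i => ?_) i
      · simp only [prj, hv, Pi.smul_apply, Fin.snoc_last, smul_eq_mul, mul_one]
        have : ((q:ℝ) : AddCircle (1:ℝ)) = 0 := by
          rw [AddCircle.coe_eq_zero_iff]
          exact ⟨q, by simp⟩
        rw [this, norm_zero]; exact hδ0
      · simp only [prj, hv, Pi.smul_apply, Fin.snoc_castSucc, smul_eq_mul]
        refine le_trans ?_ hδ
        unfold normZ
        rw [dist_zero_right]
        exact norm_le_pi_norm (fun i => (((q:ℝ) * α i : ℝ) : AddCircle (1:ℝ))) i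
    have n2 : ‖j • prj ((q:ℝ) • v)‖ ≤ ρ := by
      calc _ ≤ j * ‖prj ((q:ℝ) • v)‖ := norm_nsmul_le
        _ ≤ L * δ := by
            have : 0 ≤ L := le_trans (Nat.cast_nonneg j) hjL
            gcongr
        _ ≤ ρ := hL
    have n3 : ‖prj ((s' - m * h) • v)‖ ≤ ρ := by
      refine (prj_norm_le _).trans ?_
      rw [norm_smul, Real.norm_eq_abs, abs_of_nonneg (by linarith)]
      refine le_trans ?_ hhρ
      gcongr
      linarith
    rw [key]
    have t1 := norm_sub_le (z - x) (j • prj ((q:ℝ) • v) + prj ((s' - m * h) • v))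
    have t2 := norm_add_le (j • prj ((q:ℝ) • v)) (prj ((s' - m * h) • v))
    linarith

lemma vol_ball_le {D : ℕ} (x : Fin D → AddCircle (1:ℝ)) (ε : ℝ) (hε : 0 ≤ ε) :
    volume (ball x ε) ≤ ENNReal.ofReal ((2 * ε) ^ D) := by
  refine (measure_mono ball_subset_closedBall).trans ?_
  rw [closedBall_pi _ hε, volume_pi_pi, ENNReal.ofReal_pow (by positivity)]
  calc _ ≤ ∏ i : Fin D, ENNReal.ofReal (2 * ε) := by
        refine Finset.prod_le_prod' fun i _ => ?_
        rw [AddCircle.volume_closedBall]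
        exact ENNReal.ofReal_le_ofReal (min_le_right _ _)
    _ = _ := by simp

lemma orbit_aux {d : ℕ} (v : Fin (d+1) → ℝ) (hv : v (Fin.last d) = 1) (M : ℝ)
    (g : ℝ → Fin (d+1) → ℝ) (p : ℝ → ℝ) (hp0 : ∀ t, 0 ≤ p t) (hpM : ∀ t, p t ≤ M)
    (hg : ∀ t, HasDerivAt g (p t • v) t) (t : ℝ) (ht : 0 ≤ t) :
    ∃ s, 0 ≤ s ∧ s ≤ M * t ∧ g t = g 0 + s • v := by
  have hgi : ∀ i t, HasDerivAt (fun t => g t i) (p t * v i) t := by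
    intro i t
    have := (hasDerivAt_pi.1 (hg t)) i
    simpa using this
  have hl : ∀ t, HasDerivAt (fun t => g t (Fin.last d)) (p t) t := by
    intro t
    simpa [hv] using hgi (Fin.last d) t
  refine ⟨g t (Fin.last d) - g 0 (Fin.last d), ?_, ?_, ?_⟩
  · have : Monotone (fun t => g t (Fin.last d)) :=
      monotone_of_deriv_nonneg (fun t => (hl t).differentiableAt) (fun t => by
        rw [(hl t).deriv]; exact hp0 t)
    have := this ht
    simpa using this
  · have : Monotone (fun t => M * t - g t (Fin.last d)) :=
      monotone_of_hasDerivAt_nonneg (f' := fun t => M * 1 - p t)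
        (fun t => ((hasDerivAt_id t).const_mul M).sub (hl t))
        (fun t => by simpa using hpM t)
    have := this ht
    simp only [mul_zero] at this
    linarith
  · funext i
    have hc : ∀ t, HasDerivAt (fun t => g t i - g t (Fin.last d) * v i) 0 t := by
      intro t
      have := (hgi i t).sub ((hl t).mul_const (v i))
      rw [sub_self] at this
      exact this
    have := is_const_of_deriv_eq_zero (fun t => (hc t).differentiableAt) (fun t => (hc t).deriv) t 0
    simp only [Pi.add_apply, Pi.smul_apply, smul_eq_mul]
    linarith

/-- The time-one map of a positive `C¹` reparametrization of the linear flow in direction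
`(α,1)` on `𝕋^{d+1}`, for `α ∉ Ω_d(2/d)`, fails the monotone shrinking target property:
around any point there is a nonincreasing sequence of radii with `∑ rₙ^{d+1} = ∞` whose
limsup target set is `μ_φ`-null. -/
theorem stmt15 (d : ℕ) (hd : 0 < d) (α : Fin d → ℝ)
    (Q : ℕ → ℕ) (hQ1 : ∀ n, 1 ≤ Q n) (hQgrow : ∀ n, 2 * Q n ≤ Q (n+1))
    (hQapprox : ∀ n, 1 ≤ n → normZ (fun i => (Q n : ℝ) * α i) ≤
      1 / ((n : ℝ)^(2*d+5) * (Q n : ℝ) ^ ((2:ℝ)/(d:ℝ))))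
    (φ : (Fin (d+1) → AddCircle (1:ℝ)) → ℝ) (hφpos : ∀ x, 0 < φ x)
    (hφC1 : ContDiff ℝ 1 (fun y : Fin (d+1) → ℝ => φ (fun i => ((y i : ℝ) : AddCircle (1:ℝ)))))
    (F : ℝ → (Fin (d+1) → AddCircle (1:ℝ)) → (Fin (d+1) → AddCircle (1:ℝ)))
    (hF0 : F 0 = id) (hFadd : ∀ s t, F (s + t) = F s ∘ F t)
    (Flift : ℝ → (Fin (d+1) → ℝ) → (Fin (d+1) → ℝ))
    (hlift : ∀ t : ℝ, ∀ y : Fin (d+1) → ℝ,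
      (fun i => ((Flift t y i : ℝ) : AddCircle (1:ℝ))) = F t (fun i => ((y i : ℝ) : AddCircle (1:ℝ))))
    (hODE : ∀ y : Fin (d+1) → ℝ, ∀ t : ℝ,
      HasDerivAt (fun s => Flift s y)
        (φ (fun i => ((Flift t y i : ℝ) : AddCircle (1:ℝ))) • (Fin.snoc α (1:ℝ) : Fin (d+1) → ℝ)) t)
    (μφ : Measure (Fin (d+1) → AddCircle (1:ℝ)))
    (hμφ : μφ = (volume.withDensity (fun x => ENNReal.ofReal (φ x)⁻¹) Set.univ)⁻¹ •
        volume.withDensity (fun x => ENNReal.ofReal (φ x)⁻¹))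
    (x : Fin (d+1) → AddCircle (1:ℝ)) :
    ∃ r : ℕ → ℝ, Antitone r ∧ (∀ n, 0 ≤ r n) ∧ ¬ Summable (fun n => r n ^ (d+1)) ∧
      μφ {y | ∃ᶠ n in atTop, (F 1)^[n] y ∈ ball x (r n)} = 0 := by
  obtain ⟨M, hM1, hM⟩ : ∃ M : ℝ, 1 ≤ M ∧ ∀ x, φ x ≤ M := by
    obtain ⟨M, hM⟩ := (isCompact_Icc (a := (0 : Fin (d+1) → ℝ)) (b := 1)).bddAbove_image
      hφC1.continuous.continuousOn
    refine ⟨max M 1, le_max_right _ _, fun x => ?_⟩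
    obtain ⟨z, hz, rfl⟩ := prj_surj' x
    exact (hM (Set.mem_image_of_mem _ hz)).trans (le_max_left _ _)
  have hM0 : 0 < M := by linarith
  set v : Fin (d+1) → ℝ := Fin.snoc α (1:ℝ) with hv
  have hiter : ∀ n : ℕ, (F 1)^[n] = F n := by
    intro n
    induction n with
    | zero => simp [hF0]
    | succ n ih => rw [Function.iterate_succ', ih, ← hFadd]; rw [Nat.cast_succ, add_comm (1:ℝ)]
  have horb : ∀ (n : ℕ) y, ∃ s, 0 ≤ s ∧ s ≤ M * n ∧ y = (F 1)^[n] y - prj (s • v) := by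
    intro n y
    obtain ⟨z, rfl⟩ := prj_surj y
    obtain ⟨s, h0, h1, h2⟩ := orbit_aux v (by simp [hv]) M (fun t => Flift t z) _
      (fun t => (hφpos _).le) (fun t => hM _) (hODE z) n (Nat.cast_nonneg n)
    refine ⟨s, h0, h1, ?_⟩
    have a1 : prj (Flift n z) = F n (prj z) := hlift n z
    have a2 : prj (Flift 0 z) = prj z := by
      have := hlift 0 z
      rw [hF0] at this
      exact this
    rw [hiter, ← a1, h2, ← a2]
    funext i
    simp [prj]
  -- reduce to volume
  suffices H : ∃ r : ℕ → ℝ, Antitone r ∧ (∀ n, 0 ≤ r n) ∧ ¬ Summable (fun n => r n ^ (d+1)) ∧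
      (volume : Measure (Fin (d+1) → AddCircle (1:ℝ)))
        {y | ∃ᶠ n in atTop, (F 1)^[n] y ∈ ball x (r n)} = 0 by
    obtain ⟨r, h1, h2, h3, h4⟩ := H
    refine ⟨r, h1, h2, h3, ?_⟩
    rw [hμφ, Measure.smul_apply, withDensity_absolutelyContinuous _ _ h4, smul_zero]
  have hd' : (d:ℝ) ≠ 0 := by exact_mod_cast hd.ne'
  set K : ℕ → ℝ := fun k => (k:ℝ) + 1 with hK
  have hK1 : ∀ k, 1 ≤ K k := fun k => by simp [hK]
  set q : ℕ → ℕ := fun k => Q (k+1) with hq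
  have hq1 : ∀ k, (1:ℝ) ≤ q k := fun k => by exact_mod_cast hQ1 (k+1)
  set c : ℕ → ℝ := fun k => (q k : ℝ) ^ ((1:ℝ)/d) with hc
  have hc1 : ∀ k, 1 ≤ c k := fun k => Real.one_le_rpow (hq1 k) (by positivity)
  have hcd : ∀ k, c k ^ d = q k := by
    intro k
    simp only [hc]
    rw [← Real.rpow_natCast, ← Real.rpow_mul (by positivity), one_div_mul_cancel hd', Real.rpow_one]
  have hc2 : ∀ k, (q k : ℝ) ^ ((2:ℝ)/d) = c k ^ 2 := by
    intro k
    simp only [hc]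
    rw [← Real.rpow_natCast, ← Real.rpow_mul (by positivity)]
    congr 1
    push_cast; ring
  have hK0 : ∀ k, 0 < K k := fun k => by linarith [hK1 k]
  have hc0 : ∀ k, 0 < c k := fun k => by linarith [hc1 k]
  set ρ : ℕ → ℝ := fun k => 1 / (K k ^ 2 * c k) with hρ
  have hρ0 : ∀ k, 0 < ρ k := fun k => by
    have := hK0 k; have := hc0 k; simp only [hρ]; positivity
  have hρ1 : ∀ k, ρ k ≤ 1 := fun k => by
    have := hK0 k; have := hc0 k
    simp only [hρ]
    rw [div_le_one (by positivity)]
    exact one_le_mul_of_one_le_of_one_le (one_le_pow₀ (hK1 k)) (hc1 k)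
  set L : ℕ → ℝ := fun k => K k ^ (2*d+3) * c k with hL
  have hL0 : ∀ k, 0 < L k := fun k => by
    have := hK0 k; have := hc0 k; simp only [hL]; positivity
  set N : ℕ → ℕ := fun k => ⌊L k * q k / M⌋₊ with hN
  set A : ℝ := ‖v‖ + 1 with hA
  have hA1 : 1 ≤ A := by simp [hA]
  have hA0 : 0 < A := by linarith
  have hEk : ∀ k, volume {y | ∃ n ≤ N k, (F 1)^[n] y ∈ ball x (ρ k)} ≤
      ENNReal.ofReal (2 * A * 6 ^ (d+1) * (1 / K k ^ 2)) := by
    intro k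
    have hh : 0 < ρ k / A := div_pos (hρ0 k) hA0
    have hsub : {y | ∃ n ≤ N k, (F 1)^[n] y ∈ ball x (ρ k)} ⊆
        ⋃ m ∈ Finset.range (⌊(q k:ℝ) / (ρ k / A)⌋₊ + 1),
          ball (x - prj (((m:ℝ) * (ρ k / A)) • v)) (3 * ρ k) := by
      rintro y ⟨n, hn, hy⟩
      obtain ⟨s, hs0, hs1, hs2⟩ := horb n y
      have happ := hQapprox (k+1) (by omega)
      obtain ⟨m, hm, hmem⟩ := cover_aux α (q k) (hQ1 (k+1)) _ (L k) (ρ k) (ρ k / A) happ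
        (by
          have e : (Q (k+1) : ℝ) ^ ((2:ℝ)/d) = c k ^ 2 := hc2 k
          rw [e]
          have e2 : ((k + 1 : ℕ) : ℝ) = K k := by simp [hK]
          rw [e2]
          have := hK0 k; have := hc0 k
          simp only [hL, hρ]
          apply le_of_eq
          field_simp
          try ring) hh
        (by
          rw [div_mul_eq_mul_div, div_le_iff₀ hA0]
          have := hρ0 k
          gcongr
          simp [hA, hv]) x _ hy s hs0
        (by
          refine hs1.trans ?_
          have h1 : (n:ℝ) ≤ L k * q k / M :=
            le_trans (by exact_mod_cast hn) (Nat.floor_le (by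
              have := hL0 k
              positivity))
          rw [le_div_iff₀ hM0] at h1
          linarith)
      rw [← hv, ← hs2] at hmem
      exact Set.mem_biUnion hm hmem
    refine (measure_mono hsub).trans ((measure_biUnion_finset_le _ _).trans ?_)
    refine (Finset.sum_le_sum fun m _ => vol_ball_le _ _ (by have := hρ0 k; positivity)).trans ?_
    rw [Finset.sum_const, Finset.card_range, nsmul_eq_mul, ← ENNReal.ofReal_natCast,
      ← ENNReal.ofReal_mul (by positivity)]
    apply ENNReal.ofReal_le_ofReal
    have h1 : ((⌊(q k:ℝ) / (ρ k / A)⌋₊ + 1 : ℕ) : ℝ) ≤ 2 * (q k * A / ρ k) := by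
      push_cast
      have b1 : (⌊(q k:ℝ) / (ρ k / A)⌋₊ : ℝ) ≤ q k * A / ρ k := by
        refine (Nat.floor_le (by positivity)).trans (le_of_eq ?_)
        rw [div_div_eq_mul_div]
      have b2 : 1 ≤ q k * A / ρ k := by
        rw [one_le_div (hρ0 k)]
        exact (hρ1 k).trans (one_le_mul_of_one_le_of_one_le (hq1 k) hA1)
      linarith
    have hρk := hρ0 k
    calc _ ≤ 2 * (q k * A / ρ k) * (2 * (3 * ρ k)) ^ (d+1) := by gcongr
      _ = 2 * A * 6 ^ (d+1) * (q k * ρ k ^ d) := by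
          have : (2 * (3 * ρ k)) ^ (d+1) = 6 ^ (d+1) * (ρ k ^ d * ρ k) := by
            rw [← pow_succ, ← mul_pow]; ring
          rw [this]
          field_simp
      _ ≤ _ := by
          have : q k * ρ k ^ d = 1 / (K k ^ 2) ^ d := by
            have := hK0 k; have := hc0 k
            simp only [hρ]
            rw [← hcd, div_pow, mul_pow]
            field_simp
            try simp
          rw [this]
          have hKp := hK0 k
          have : K k ^ 2 ≤ (K k ^ 2) ^ d := le_self_pow₀ (one_le_pow₀ (hK1 k)) hd.ne'
          gcongr
  refine core_aux volume (F 1) x (d+1) ρ N (fun k => (hρ0 k).le) hρ1 ?_ ?_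
  · intro B
    obtain ⟨k, hk⟩ := exists_nat_gt (M * (B + 1))
    refine ⟨k, ?_⟩
    have h1 : L k * q k / M < N k + 1 := Nat.lt_floor_add_one _
    have h2 : 0 < ρ k ^ (d+1) := pow_pos (hρ0 k) _
    have h3 : ρ k ^ (d+1) ≤ 1 := pow_le_one₀ (hρ0 k).le (hρ1 k)
    have h4 : L k * q k / M * ρ k ^ (d+1) = K k / M := by
      have := hK0 k; have := hc0 k
      simp only [hL, hρ]
      rw [← hcd]
      have e : (1 / (K k ^ 2 * c k)) ^ (d+1) = 1 / (K k ^ (2*d+2) * (c k ^ d * c k)) := by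
        rw [div_pow, one_pow, mul_pow, ← pow_mul, pow_succ (c k)]
        congr 3
      rw [e]
      have e2 : K k ^ (2*d+3) = K k ^ (2*d+2) * K k := by rw [← pow_succ]
      rw [e2]
      field_simp
    have h5 : B + 1 < K k / M := by
      rw [lt_div_iff₀ hM0]
      simp only [hK]
      linarith
    have h6 := mul_lt_mul_of_pos_right h1 h2
    rw [h4, add_mul, one_mul] at h6
    linarith
  · refine ne_top_of_le_ne_top ?_ (ENNReal.tsum_le_tsum hEk)
    have hs : Summable (fun k => 2 * A * 6 ^ (d+1) * (1 / K k ^ 2)) := by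
      apply Summable.mul_left
      have := (summable_nat_add_iff 1).2 (Real.summable_one_div_nat_pow.2 (one_lt_two))
      simpa [hK] using this
    exact hs.tsum_ofReal_ne_top
end
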